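/- arXiv:math/0301322 — 2 statements merged into one kernel-verified Lean document; each statement's English description precedes it below -/
import Mathlib

section
/- Let D be a bounded domain in ℂ^n, let φ be a bounded, positive, continuous function on D, and let β be a measure on D given by a positive continuous density with respect to Lebesgue measure. Set Ω = {(z,ζ) ∈ D × ℂ : |ζ|² < φ(z)}, endowed with the measure μ_Ω = β ⊗ (1/π)·Lebesgue on ℂ, and for a positive integer m set G = {(z,Z) ∈ D × ℂ^m : ‖Z‖² < φ(z)}, endowed with μ_G = β ⊗ (m!/π^m)·Lebesgue on ℂ^m. Let K_Ω and K_G be the Bergman (reproducing) kernels of the Bergman spaces A²(Ω,μ_Ω) and A²(G,μ_G), and suppose L : D × [0,∞) → ℝ is such that r ↦ L(z,r) is m-1 times differentiable for each z ∈ D and K_Ω((z,ζ),(z,ζ)) = L(z,|ζ|²) for all (z,ζ) ∈ Ω. Then for all (z,Z) ∈ G, K_G((z,Z),(z,Z)) = (1/m!) · (∂^{m-1}L/∂r^{m-1})(z, ‖Z‖²). -/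
open MeasureTheory Complex

/-- The `k`-th Taylor coefficient at the origin. -/
noncomputable def taylorCoeff (k : ℕ) (h : ℂ → ℂ) : ℂ := iteratedDeriv k h 0 / k.factorial

lemma integral_circleMap_div_pow {R : ℝ} (hR : 0 < R) (k : ℕ) {h : ℂ → ℂ}
    (hh : DifferentiableOn ℂ h (Metric.closedBall 0 R)) :
    ∫ θ in (0 : ℝ)..2 * Real.pi, h (circleMap 0 R θ) / circleMap 0 R θ ^ k =
      2 * Real.pi * taylorCoeff k h := by
  have key := hh.circleIntegral_one_div_sub_center_pow_smul hR k
  have hI : ∫ θ in (0 : ℝ)..2 * Real.pi, I * (h (circleMap 0 R θ) / circleMap 0 R θ ^ k) =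
      2 * Real.pi * I / k.factorial * iteratedDeriv k h 0 := by
    rw [← smul_eq_mul (_ / _), ← key, circleIntegral]
    refine intervalIntegral.integral_congr fun θ _ => ?_
    have := circleMap_ne_center hR.ne' (c := 0) (θ := θ)
    simp only [deriv_circleMap, sub_zero, smul_eq_mul]
    field_simp
    ring
  rw [intervalIntegral.integral_const_mul] at hI
  apply mul_left_cancel₀ I_ne_zero
  rw [hI, taylorCoeff]
  ring

lemma hasSum_taylorCoeff {R : ℝ} (hR : 1 < R) {h : ℂ → ℂ}
    (hh : DifferentiableOn ℂ h (Metric.ball 0 R)) :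
    HasSum (fun k => taylorCoeff k h) (h 1) := by
  have := hasSum_taylorSeries_on_ball hh (z := 1) (by simpa using hR)
  simpa only [taylorCoeff, sub_zero, one_pow, smul_eq_mul, one_mul, div_eq_inv_mul] using this

lemma taylorCoeff_comp_mul (k : ℕ) (c : ℂ) (h : ℂ → ℂ) :
    taylorCoeff k (fun x => h (c * x)) = c ^ k * taylorCoeff k h := by
  have key : ∀ k, iteratedDeriv k (fun x => h (c * x)) =
      fun x => c ^ k * iteratedDeriv k h (c * x) := by
    intro k
    induction k with
    | zero => simp
    | succ k ih =>
      funext x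
      rw [iteratedDeriv_succ, ih, iteratedDeriv_succ, deriv_const_mul_field,
        deriv_comp_mul_left c (iteratedDeriv k h), smul_eq_mul]
      ring
  simp only [taylorCoeff, key, mul_zero]
  ring

lemma taylorCoeff_const_mul_pow (k : ℕ) (c : ℂ) :
    taylorCoeff k (fun x => (c * x) ^ k) = c ^ k := by
  rw [taylorCoeff_comp_mul k c (fun x => x ^ k), taylorCoeff, iteratedDeriv_fun_pow_zero]
  simp [Nat.factorial_ne_zero]

variable {E F : Type*} [NormedAddCommGroup E] [NormedSpace ℂ E] [NormedAddCommGroup F]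
  [NormedSpace ℂ F]

lemma differentiableOn_taylorCoeff [FiniteDimensional ℂ E] [FiniteDimensional ℂ F]
    {D : Set E} {G : Set (E × F)} (hG : IsOpen G)
    (hDG : ∀ z ∈ D, (z, (0 : F)) ∈ G) {g : E × F → ℂ} (hg : DifferentiableOn ℂ g G) (W : F)
    (k : ℕ) : DifferentiableOn ℂ (fun z => taylorCoeff k fun t : ℂ => g (z, t • W)) D := by
  intro z₀ hz₀
  have : FiniteDimensional ℝ E := FiniteDimensional.complexToReal E
  have : FiniteDimensional ℝ F := FiniteDimensional.complexToReal F
  obtain ⟨ε, hε, hε'⟩ : ∃ ε > 0, Metric.ball (z₀, (0 : F)) ε ⊆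
      G ∩ {p | ‖g p‖ < ‖g (z₀, 0)‖ + 1} := by
    have hG' := hG.mem_nhds (hDG z₀ hz₀)
    have hc : ContinuousAt (fun p => ‖g p‖) (z₀, (0 : F)) :=
      (hg.continuousOn.continuousAt hG').norm
    exact Metric.mem_nhds_iff.1 (Filter.inter_mem hG' (hc (Iio_mem_nhds (lt_add_one _))))
  set M := ‖g (z₀, 0)‖ + 1 with hM
  have hMpos : 0 < M := by positivity
  obtain ⟨R, hR, hRW⟩ : ∃ R > 0, R * ‖W‖ < ε := by
    refine ⟨ε / (‖W‖ + 1), by positivity, ?_⟩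
    rw [div_mul_eq_mul_div, div_lt_iff₀ (by positivity)]
    nlinarith
  have hmem : ∀ z ∈ Metric.ball z₀ ε, ∀ t : ℂ, ‖t‖ ≤ R → (z, t • W) ∈ Metric.ball (z₀, (0 : F)) ε := by
    intro z hz t ht
    rw [← ball_prod_same]
    refine ⟨hz, ?_⟩
    rw [mem_ball_zero_iff, norm_smul]
    exact (mul_le_mul_of_nonneg_right ht (norm_nonneg _)).trans_lt hRW
  have hdiff : ∀ z ∈ Metric.ball z₀ ε, ∀ t : ℂ, ‖t‖ ≤ R → DifferentiableAt ℂ g (z, t • W) :=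
    fun z hz t ht => hg.differentiableAt (hG.mem_nhds (hε' (hmem z hz t ht)).1)
  have hcirc : ∀ θ, ‖circleMap 0 R θ‖ ≤ R := fun θ => by simp [abs_of_pos hR]
  have hne : ∀ θ, circleMap 0 R θ ≠ 0 := fun θ => circleMap_ne_center hR.ne'
  have hcont : ∀ z ∈ Metric.ball z₀ ε,
      Continuous fun θ => g (z, circleMap 0 R θ • W) / circleMap 0 R θ ^ k := by
    intro z hz
    refine Continuous.div ?_ (by fun_prop) fun θ => pow_ne_zero _ (hne θ)
    refine continuous_iff_continuousAt.2 fun θ => ?_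
    exact ContinuousAt.comp (f := fun θ => (z, circleMap 0 R θ • W))
      (hdiff z hz _ (hcirc θ)).continuousAt (by fun_prop)
  have hint : DifferentiableAt ℂ (fun z => ∫ θ in (0 : ℝ)..2 * Real.pi,
      g (z, circleMap 0 R θ • W) / circleMap 0 R θ ^ k) z₀ := by
    have hd : ∀ θ, DifferentiableOn ℂ (fun z => g (z, circleMap 0 R θ • W) / circleMap 0 R θ ^ k)
        (Metric.ball z₀ ε) := by
      intro θ z hz
      apply DifferentiableAt.differentiableWithinAt
      have h1 : DifferentiableAt ℂ (fun z => g (z, circleMap 0 R θ • W)) z :=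
        DifferentiableAt.comp (f := fun z => (z, circleMap 0 R θ • W)) z
          (hdiff z hz _ (hcirc θ)) (by fun_prop)
      simpa only [div_eq_mul_inv] using h1.mul_const _
    refine (intervalIntegral.hasFDerivAt_integral_of_dominated_loc_of_lip (𝕜 := ℂ) (μ := volume)
      (F := fun z θ => g (z, circleMap 0 R θ • W) / circleMap 0 R θ ^ k)
      (F' := fun θ => fderiv ℂ (fun z => g (z, circleMap 0 R θ • W) / circleMap 0 R θ ^ k) z₀)
      (bound := fun _ => (2 * (M / R ^ k)) / (ε / 2))
      (Metric.ball_mem_nhds z₀ (half_pos hε)) ?_ ?_ ?_ ?_ ?_ ?_).2.differentiableAt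
    · filter_upwards [Metric.ball_mem_nhds z₀ hε] with z hz
      exact (hcont z hz).aestronglyMeasurable
    · exact (hcont z₀ (Metric.mem_ball_self hε)).intervalIntegrable _ _
    · have : (fun θ => fderiv ℂ (fun z => g (z, circleMap 0 R θ • W) / circleMap 0 R θ ^ k) z₀) =
          fun θ => (circleMap 0 R θ ^ k)⁻¹ •
            (fderiv ℂ g (z₀, circleMap 0 R θ • W)).comp (ContinuousLinearMap.inl ℂ E F) := by
        funext θ
        have h1 : HasFDerivAt (fun z => g (z, circleMap 0 R θ • W))
            ((fderiv ℂ g (z₀, circleMap 0 R θ • W)).comp (ContinuousLinearMap.inl ℂ E F)) z₀ :=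
          HasFDerivAt.comp (f := fun z => (z, circleMap 0 R θ • W)) z₀
            (hdiff z₀ (Metric.mem_ball_self hε) _ (hcirc θ)).hasFDerivAt
            (hasFDerivAt_prodMk_left z₀ _)
        simp only [div_eq_mul_inv]
        exact (h1.mul_const _).fderiv
      rw [this]
      borelize E F
      have hm : Measurable fun θ => fderiv ℂ g (z₀, circleMap 0 R θ • W) :=
        (measurable_fderiv ℂ g).comp (by fun_prop)
      have hm2 : StronglyMeasurable fun θ => fderiv ℂ g (z₀, circleMap 0 R θ • W) :=
        hm.stronglyMeasurable
      refine StronglyMeasurable.aestronglyMeasurable ?_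
      have hm3 : Continuous fun θ => (circleMap 0 R θ ^ k)⁻¹ :=
        Continuous.inv₀ (by fun_prop) fun θ => pow_ne_zero _ (hne θ)
      exact hm3.stronglyMeasurable.smul (((ContinuousLinearMap.compL ℂ E (E × F) ℂ).flip
        (ContinuousLinearMap.inl ℂ E F)).continuous.comp_stronglyMeasurable hm2)
    · refine .of_forall fun θ _ => ?_
      have hb : ∀ z ∈ Metric.ball z₀ ε,
          ‖g (z, circleMap 0 R θ • W) / circleMap 0 R θ ^ k‖ ≤ M / R ^ k := by
        intro z hz
        rw [norm_div, norm_pow, norm_circleMap_zero, abs_of_pos hR]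
        gcongr
        exact (hε' (hmem z hz _ (hcirc θ))).2.le
      refine Convex.lipschitzOnWith_of_nnnorm_fderiv_le (𝕜 := ℂ) (fun z hz => ?_) (fun z hz => ?_)
        (convex_ball _ _)
      · exact (hd θ).differentiableAt
          (Metric.isOpen_ball.mem_nhds (Metric.ball_subset_ball (by linarith) hz))
      · rw [← NNReal.coe_le_coe, coe_nnnorm, Real.coe_nnabs, abs_of_pos (by positivity)]
        have hsub : Metric.ball z (ε / 2) ⊆ Metric.ball z₀ ε :=
          Metric.ball_subset_ball' (by rw [Metric.mem_ball] at hz; linarith)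
        refine Complex.norm_fderiv_le_div_of_mapsTo_ball ((hd θ).mono hsub) ?_ (half_pos hε)
        intro y hy
        rw [mem_closedBall_iff_norm]
        refine (norm_sub_le _ _).trans ?_
        have h1 := hb y (hsub hy)
        have h2 := hb z (hsub (Metric.mem_ball_self (half_pos hε)))
        linarith
    · exact intervalIntegrable_const
    · exact .of_forall fun θ _ => ((hd θ).differentiableAt (Metric.ball_mem_nhds z₀ hε)).hasFDerivAt
  refine DifferentiableAt.differentiableWithinAt ?_
  refine (hint.const_mul ((2 * Real.pi : ℂ)⁻¹)).congr_of_eventuallyEq ?_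
  filter_upwards [Metric.ball_mem_nhds z₀ hε] with z hz
  have hh : DifferentiableOn ℂ (fun t : ℂ => g (z, t • W)) (Metric.closedBall 0 R) := by
    intro t ht
    exact (DifferentiableAt.comp (f := fun t : ℂ => (z, t • W)) t
      (hdiff z hz t (by simpa using ht)) (by fun_prop)).differentiableWithinAt
  rw [integral_circleMap_div_pow hR k hh, inv_mul_cancel_left₀]
  simp [Real.pi_ne_zero]

lemma integrable_and_integral_of_average {X : Type*} [MeasurableSpace X] {μ : Measure X}
    [SFinite μ] {T : ℝ → X → X} (hT : Measurable (Function.uncurry T))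
    (hmp : ∀ θ, MeasurePreserving (T θ) μ μ) {f g : X → ℂ} (hf : Integrable f μ)
    (hfg : ∀ᵐ x ∂μ, ∫ θ in (0 : ℝ)..2 * Real.pi, f (T θ x) = 2 * Real.pi * g x) :
    Integrable g μ ∧ ∫ x, f x ∂μ = ∫ x, g x ∂μ := by
  have hpi : (2 * Real.pi : ℂ) ≠ 0 := by simp [Real.pi_ne_zero]
  have hpos : (0 : ℝ) ≤ 2 * Real.pi := by positivity
  set κ : Measure ℝ := volume.restrict (Set.Ioc 0 (2 * Real.pi)) with hκ
  have hskew : MeasurePreserving (fun p : ℝ × X => (p.1, T p.1 p.2)) (κ.prod μ) (κ.prod μ) :=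
    (MeasurePreserving.id κ).skew_product hT (.of_forall fun θ => (hmp θ).map_eq)
  have hint : Integrable (fun p : ℝ × X => f (T p.1 p.2)) (κ.prod μ) :=
    hskew.integrable_comp_of_integrable (g := fun p : ℝ × X => f p.2) (hf.comp_snd κ)
  have hae : ∀ᵐ x ∂μ, ∫ θ, f (T θ x) ∂κ = 2 * Real.pi * g x := by
    filter_upwards [hfg] with x hx
    rw [← hx, intervalIntegral.integral_of_le hpos]
  have h2 : Integrable (fun x => 2 * Real.pi * g x) μ :=
    (hint.integral_prod_right).congr hae
  refine ⟨by simpa only [inv_mul_cancel_left₀ hpi] using h2.const_mul (2 * Real.pi : ℂ)⁻¹, ?_⟩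
  have hswap := integral_integral_swap (f := fun θ x => f (T θ x)) hint
  have hin : ∀ θ, ∫ x, f (T θ x) ∂μ = ∫ x, f x ∂μ := by
    intro θ
    have := integral_map (μ := μ) (φ := T θ) (hmp θ).measurable.aemeasurable (f := f)
      (by rw [(hmp θ).map_eq]; exact hf.aestronglyMeasurable)
    rw [← this, (hmp θ).map_eq]
  simp only [hin] at hswap
  rw [integral_congr_ae hae, integral_const_mul] at hswap
  simp only [integral_const, hκ, Measure.restrict_apply, MeasurableSet.univ, measureReal_def,
    Set.univ_inter, Real.volume_Ioc, sub_zero, ENNReal.toReal_ofReal hpos, real_smul] at hswap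
  push_cast at hswap
  exact mul_left_cancel₀ hpi hswap

lemma measurePreserving_mul_of_norm_eq_one {ι : Type*} [Fintype ι] (u : ι → ℂ)
    (hu : ∀ i, ‖u i‖ = 1) : MeasurePreserving (fun (Z : ι → ℂ) i => u i * Z i) := by
  refine volume_preserving_pi (f := fun i z => u i * z) fun i => ?_
  exact (rotation ⟨u i, by simp [Submonoid.unitSphere, hu i]⟩).measurePreserving

lemma isOpen_sum_norm_sq_lt {ι : Type*} [Fintype ι] (r : ℝ) :
    IsOpen {Z : ι → ℂ | ∑ i, ‖Z i‖ ^ 2 < r} :=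
  isOpen_lt (by fun_prop) continuous_const

lemma volume_sum_norm_sq_lt_lt_top {ι : Type*} [Fintype ι] (r : ℝ) :
    volume {Z : ι → ℂ | ∑ i, ‖Z i‖ ^ 2 < r} < ⊤ := by
  refine (measure_mono (t := Metric.closedBall 0 (√r)) fun Z hZ => ?_).trans_lt
    measure_closedBall_lt_top
  rw [mem_closedBall_zero_iff, pi_norm_le_iff_of_nonneg (Real.sqrt_nonneg _)]
  intro i
  apply Real.le_sqrt_of_sq_le
  exact (Finset.single_le_sum (fun j _ => sq_nonneg ‖Z j‖) (Finset.mem_univ i)).trans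
    (le_of_lt hZ)

lemma measurePreserving_mul_restrict {ι : Type*} [Fintype ι] (u : ι → ℂ)
    (hu : ∀ i, ‖u i‖ = 1) (r : ℝ) : MeasurePreserving (fun (Z : ι → ℂ) i => u i * Z i)
      (volume.restrict {Z | ∑ i, ‖Z i‖ ^ 2 < r}) (volume.restrict {Z | ∑ i, ‖Z i‖ ^ 2 < r}) := by
  have := (measurePreserving_mul_of_norm_eq_one u hu).restrict_preimage
    (isOpen_sum_norm_sq_lt r).measurableSet
  simpa [Set.preimage_ofPred_eq, hu] using this

lemma setIntegral_mul_conj_coord_pow {ι : Type*} [Fintype ι] [DecidableEq ι] (l : ι) (k : ℕ)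
    {r : ℝ} {p : (ι → ℂ) → ℂ} (hp : DifferentiableOn ℂ p {Z | ∑ i, ‖Z i‖ ^ 2 < r})
    (hpi : IntegrableOn p {Z | ∑ i, ‖Z i‖ ^ 2 < r}) :
    ∫ Z in {Z : ι → ℂ | ∑ i, ‖Z i‖ ^ 2 < r}, p Z * (starRingEnd ℂ) (Z l ^ k) =
      taylorCoeff k (fun t => p (t • (Pi.single l 1 : ι → ℂ))) *
        ∫ Z in {Z : ι → ℂ | ∑ i, ‖Z i‖ ^ 2 < r}, ((‖Z l‖ ^ 2 : ℝ) : ℂ) ^ k := by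
  set B := {Z : ι → ℂ | ∑ i, ‖Z i‖ ^ 2 < r} with hB
  have hBo : IsOpen B := isOpen_sum_norm_sq_lt r
  have hsub : ∀ Z ∈ B, ∀ u : ι → ℂ, (∀ i, ‖u i‖ ≤ 1) → (fun i => u i * Z i) ∈ B := by
    intro Z hZ u hu
    have hZ' : ∑ i, ‖Z i‖ ^ 2 < r := hZ
    refine lt_of_le_of_lt (Finset.sum_le_sum fun i _ => ?_) hZ'
    rw [norm_mul]
    gcongr
    exact mul_le_of_le_one_left (norm_nonneg _) (hu i)
  have hcomp : ∀ Z ∈ B, ∀ u : ℂ → ι → ℂ, (Differentiable ℂ u) → (∀ t, ‖t‖ ≤ 1 → ∀ i, ‖u t i‖ ≤ 1) →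
      DifferentiableOn ℂ (fun t => p (fun i => u t i * Z i)) (Metric.closedBall 0 1) := by
    intro Z hZ u hu hu1 t ht
    have h1 : DifferentiableAt ℂ p (fun i => u t i * Z i) :=
      hp.differentiableAt (hBo.mem_nhds (hsub Z hZ _ (hu1 t (by simpa using ht))))
    refine (DifferentiableAt.comp (f := fun t i => u t i * Z i) t h1 ?_).differentiableWithinAt
    rw [differentiable_pi] at hu
    rw [differentiableAt_pi]
    intro i
    exact (hu i t).mul_const _
  have hbd : IntegrableOn (fun Z => p Z * (starRingEnd ℂ) (Z l ^ k)) B := by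
    refine Integrable.mul_bdd (c := (√r) ^ k) hpi ?_ ?_
    · exact Continuous.aestronglyMeasurable (by fun_prop)
    · refine (ae_restrict_iff' hBo.measurableSet).2 (.of_forall fun Z hZ => ?_)
      rw [RCLike.norm_conj, norm_pow]
      gcongr
      apply Real.le_sqrt_of_sq_le
      exact (Finset.single_le_sum (fun j _ => sq_nonneg ‖Z j‖) (Finset.mem_univ l)).trans
        (le_of_lt hZ)
  have hone : ∀ θ, ‖circleMap 0 1 θ‖ = 1 := by simp
  obtain ⟨hi1, he1⟩ := integrable_and_integral_of_average (μ := volume.restrict B)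
    (T := fun θ Z i => (if i = l then 1 else circleMap 0 1 θ) * Z i)
    (g := fun Z => p (Z l • (Pi.single l 1 : ι → ℂ)) * (starRingEnd ℂ) (Z l ^ k))
    (by
      refine Continuous.measurable (continuous_pi fun i => ?_)
      by_cases h : i = l
      · simpa [h, Function.uncurry] using by fun_prop
      · simpa [h, Function.uncurry] using by fun_prop)
    (fun θ => measurePreserving_mul_restrict _ (fun i => by split_ifs <;> simp) r) hbd
    (by
      refine (ae_restrict_iff' hBo.measurableSet).2 (.of_forall fun Z hZ => ?_)
      have := integral_circleMap_div_pow one_pos 0 (hcomp Z hZ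
        (fun t i => if i = l then 1 else t)
        (by
          rw [differentiable_pi]
          intro i
          split_ifs <;> fun_prop)
        (by
          intro t ht i
          split_ifs <;> simp [ht]))
      simp only [pow_zero, div_one] at this
      simp only [if_true, one_mul]
      rw [intervalIntegral.integral_mul_const, this, mul_assoc]
      congr 3
      simp only [taylorCoeff, iteratedDeriv_zero, Nat.factorial_zero, Nat.cast_one, div_one]
      congr 1
      ext i
      by_cases h : i = l
      · subst h; simp
      · simp [h])
  obtain ⟨-, he2⟩ := integrable_and_integral_of_average (μ := volume.restrict B)
    (T := fun θ Z i => circleMap 0 1 θ * Z i)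
    (g := fun Z => taylorCoeff k (fun t => p (t • (Pi.single l 1 : ι → ℂ))) * ((‖Z l‖ ^ 2 : ℝ) : ℂ) ^ k)
    (by
      refine Continuous.measurable (continuous_pi fun i => ?_)
      simp only [Function.uncurry]
      fun_prop)
    (fun θ => measurePreserving_mul_restrict _ (fun i => by simp) r) hi1
    (by
      refine (ae_restrict_iff' hBo.measurableSet).2 (.of_forall fun Z hZ => ?_)
      have h1 := integral_circleMap_div_pow one_pos k (hcomp Z hZ
        (fun t i => if i = l then t else 0)
        (by
          rw [differentiable_pi]
          intro i
          split_ifs <;> fun_prop)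
        (by
          intro t ht i
          split_ifs <;> simp [ht]))
      have h2 : ∀ t, (p fun i => (if i = l then t else 0) * Z i) =
          p ((Z l * t) • (Pi.single l 1 : ι → ℂ)) := by
        intro t
        congr 1
        ext i
        by_cases h : i = l
        · subst h; simp [mul_comm]
        · simp [h]
      simp only [h2] at h1
      rw [taylorCoeff_comp_mul k (Z l) fun t => p (t • (Pi.single l 1 : ι → ℂ))] at h1
      have h3 : ∀ θ, p ((circleMap 0 1 θ * Z l) • (Pi.single l 1 : ι → ℂ)) *
          (starRingEnd ℂ) ((circleMap 0 1 θ * Z l) ^ k) =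
          p ((Z l * circleMap 0 1 θ) • (Pi.single l 1 : ι → ℂ)) / circleMap 0 1 θ ^ k *
            (starRingEnd ℂ) (Z l ^ k) := by
        intro θ
        have h4 : (starRingEnd ℂ) (circleMap 0 1 θ) = (circleMap 0 1 θ)⁻¹ := by
          rw [inv_def, normSq_eq_norm_sq, hone]; simp
        rw [map_pow, map_mul, h4, mul_comm (Z l) (circleMap 0 1 θ), mul_pow, inv_pow, map_pow]
        ring
      simp only [h3]
      rw [intervalIntegral.integral_mul_const, h1]
      have h5 : ((‖Z l‖ ^ 2 : ℝ) : ℂ) = Z l * (starRingEnd ℂ) (Z l) := by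
        rw [mul_conj, normSq_eq_norm_sq]
      rw [h5, mul_pow, map_pow]
      ring)
  rw [he1, he2, integral_const_mul]

lemma setLIntegral_norm_sq_lt {f : ℝ → ℝ} {r : ℝ} (hr : 0 < r) (hf : Continuous f)
    (hf0 : ∀ u ∈ Set.Icc 0 r, 0 ≤ f u) :
    ∫⁻ z in {z : ℂ | ‖z‖ ^ 2 < r}, ENNReal.ofReal (f (‖z‖ ^ 2)) =
      ENNReal.ofReal (Real.pi * ∫ u in (0 : ℝ)..r, f u) := by
  have hset : {z : ℂ | ‖z‖ ^ 2 < r} = Metric.ball 0 (√r) := by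
    ext z
    simp [Real.lt_sqrt (norm_nonneg z)]
  have hmeas : MeasurableSet {z : ℂ | ‖z‖ ^ 2 < r} := by rw [hset]; exact measurableSet_ball
  have hint : IntegrableOn (fun z : ℂ => f (‖z‖ ^ 2)) {z : ℂ | ‖z‖ ^ 2 < r} := by
    rw [hset]
    exact ((hf.comp (by fun_prop)).continuousOn.integrableOn_compact
      (isCompact_closedBall (0 : ℂ) (√r))).mono_set Metric.ball_subset_closedBall
  rw [← ofReal_integral_eq_lintegral_ofReal hint
    ((ae_restrict_iff' hmeas).2 (.of_forall fun z hz => hf0 _ ⟨by positivity, le_of_lt hz⟩))]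
  congr 1
  rw [← integral_indicator hmeas]
  have h1 : ({z : ℂ | ‖z‖ ^ 2 < r}.indicator fun z => f (‖z‖ ^ 2)) =
      fun z => (Set.Iio (√r)).indicator (fun y => f (y ^ 2)) ‖z‖ := by
    ext z
    simp [Set.indicator_apply, Real.lt_sqrt (norm_nonneg z)]
  rw [h1, integral_fun_norm_addHaar volume ((Set.Iio (√r)).indicator (fun y => f (y ^ 2)))]
  have h2 : ∫ y in Set.Ioi (0 : ℝ), y ^ (Module.finrank ℝ ℂ - 1) •
      (Set.Iio (√r)).indicator (fun y => f (y ^ 2)) y =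
      ∫ y in (0 : ℝ)..√r, y * f (y ^ 2) := by
    have h : ∀ y : ℝ, y ^ (Module.finrank ℝ ℂ - 1) • (Set.Iio (√r)).indicator
        (fun y => f (y ^ 2)) y = (Set.Iio (√r)).indicator (fun y => y * f (y ^ 2)) y := by
      intro y
      by_cases hy : y < √r <;> simp [hy, Complex.finrank_real_complex]
    simp only [h]
    rw [intervalIntegral.integral_of_le (Real.sqrt_nonneg r), integral_Ioc_eq_integral_Ioo,
      ← Set.Ioi_inter_Iio, setIntegral_indicator measurableSet_Iio]
  have h3 : ∫ y in (0 : ℝ)..√r, y * f (y ^ 2) = (1 / 2) * ∫ u in (0 : ℝ)..r, f u := by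
    have := intervalIntegral.integral_comp_mul_deriv (a := 0) (b := √r) (f := fun y => y ^ 2)
      (f' := fun y => 2 * y) (g := f) (fun y _ => by simpa using hasDerivAt_pow 2 y)
      (by fun_prop) hf
    simp only [Function.comp, Real.sq_sqrt hr.le] at this
    rw [zero_pow two_ne_zero] at this
    rw [← this, ← intervalIntegral.integral_const_mul]
    congr 1
    ext y
    ring
  rw [h2, h3]
  simp [measureReal_def]
  ring

lemma setLIntegral_sum_norm_sq_lt (k m : ℕ) {r : ℝ} (hr : 0 < r) :
    ∫⁻ Z in {Z : Fin (m + 1) → ℂ | ∑ i, ‖Z i‖ ^ 2 < r},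
      ENNReal.ofReal ((‖Z (Fin.last m)‖ ^ 2) ^ k) =
      ENNReal.ofReal (Real.pi ^ (m + 1) * k.factorial / (m + 1 + k).factorial *
        r ^ (m + 1 + k)) := by
  induction m generalizing r with
  | zero =>
    have hmp := volume_preserving_funUnique (Fin 1) ℂ
    have := hmp.setLIntegral_comp_preimage_emb (MeasurableEquiv.measurableEmbedding _)
      (fun z : ℂ => ENNReal.ofReal ((‖z‖ ^ 2) ^ k)) {z : ℂ | ‖z‖ ^ 2 < r}
    rw [setLIntegral_norm_sq_lt (f := fun u => u ^ k) hr (by fun_prop)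
      (fun u hu => pow_nonneg hu.1 k)] at this
    have hs : (MeasurableEquiv.funUnique (Fin 1) ℂ) ⁻¹' {z : ℂ | ‖z‖ ^ 2 < r} =
        {Z : Fin 1 → ℂ | ∑ i, ‖Z i‖ ^ 2 < r} := by
      ext Z
      simp
    rw [hs] at this
    refine Eq.trans ?_ (this.trans ?_)
    · congr!
    congr 1
    rw [integral_pow, Nat.add_comm (0 + 1) k, Nat.factorial_succ]
    have := Nat.factorial_ne_zero k
    push_cast
    simp
    field_simp
  | succ m ih =>
    have hmp := (volume_preserving_piFinSuccAbove (fun _ : Fin (m + 2) => ℂ) 0).symm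
    set B := {Z : Fin (m + 2) → ℂ | ∑ i, ‖Z i‖ ^ 2 < r} with hB
    have hBm : MeasurableSet B := (isOpen_sum_norm_sq_lt r).measurableSet
    rw [← lintegral_indicator hBm, ← hmp.lintegral_comp_emb (MeasurableEquiv.measurableEmbedding _),
      Measure.volume_eq_prod, lintegral_prod]
    swap
    · refine Measurable.aemeasurable ?_
      refine (Measurable.indicator ?_ hBm).comp (MeasurableEquiv.measurable _)
      fun_prop
    have hin : ∀ z : ℂ, ∫⁻ Z : Fin (m + 1) → ℂ, B.indicator
        (fun Z => ENNReal.ofReal ((‖Z (Fin.last (m + 1))‖ ^ 2) ^ k))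
        ((MeasurableEquiv.piFinSuccAbove (fun _ : Fin (m + 2) => ℂ) 0).symm (z, Z)) =
        {z : ℂ | ‖z‖ ^ 2 < r}.indicator (fun z => ENNReal.ofReal
          ((fun u => Real.pi ^ (m + 1) * k.factorial / (m + 1 + k).factorial *
            (r - u) ^ (m + 1 + k)) (‖z‖ ^ 2))) z := by
      intro z
      have h1 : ∀ Z, (B.indicator
        (fun Z => ENNReal.ofReal ((‖Z (Fin.last (m + 1))‖ ^ 2) ^ k))
        ((MeasurableEquiv.piFinSuccAbove (fun _ : Fin (m + 2) => ℂ) 0).symm (z, Z))) =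
        {Z : Fin (m + 1) → ℂ | ∑ i, ‖Z i‖ ^ 2 < r - ‖z‖ ^ 2}.indicator
          (fun Z => ENNReal.ofReal ((‖Z (Fin.last m)‖ ^ 2) ^ k)) Z := by
        intro Z
        have h2 : (MeasurableEquiv.piFinSuccAbove (fun _ : Fin (m + 2) => ℂ) 0).symm (z, Z) =
          Fin.cons z Z := by
          rw [MeasurableEquiv.symm_apply_eq]
          ext i
          all_goals simp [MeasurableEquiv.piFinSuccAbove]
        simp [Set.indicator_apply, h2, hB, Fin.sum_univ_succ, lt_sub_iff_add_lt', ← Fin.succ_last]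
      simp only [h1]
      rw [lintegral_indicator (isOpen_sum_norm_sq_lt _).measurableSet]
      by_cases hz : ‖z‖ ^ 2 < r
      · rw [ih (sub_pos.2 hz), Set.indicator_of_mem (by exact hz)]
      · rw [Set.indicator_of_notMem (by exact hz)]
        have : {Z : Fin (m + 1) → ℂ | ∑ i, ‖Z i‖ ^ 2 < r - ‖z‖ ^ 2} = ∅ := by
          ext Z
          have : 0 ≤ ∑ i, ‖Z i‖ ^ 2 := by positivity
          simp only [Set.mem_ofPred_eq, Set.mem_empty_iff_false, iff_false, not_lt]
          linarith
        simp [this]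
    simp only [hin]
    rw [lintegral_indicator (measurableSet_lt (by fun_prop) (by fun_prop)),
      setLIntegral_norm_sq_lt (f := fun u => Real.pi ^ (m + 1) * k.factorial /
        (m + 1 + k).factorial * (r - u) ^ (m + 1 + k)) hr (by fun_prop) (fun u hu => by
        have := sub_nonneg.2 hu.2
        positivity)]
    congr 1
    rw [intervalIntegral.integral_const_mul, intervalIntegral.integral_comp_sub_left (fun u => u ^ (m + 1 + k)), integral_pow,
      show m + 1 + 1 + k = (m + 1 + k) + 1 by ring, Nat.factorial_succ]
    have := Nat.factorial_ne_zero (m + 1 + k)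
    push_cast
    simp
    field_simp
    ring

lemma measurePreserving_of_sum_norm_sq_eq {ι : Type*} [Fintype ι] (U : (ι → ℂ) ≃L[ℂ] (ι → ℂ))
    (hU : ∀ Y, ∑ i, ‖U Y i‖ ^ 2 = ∑ i, ‖Y i‖ ^ 2) : MeasurePreserving U := by
  refine ⟨U.continuous.measurable, ?_⟩
  have hd : (U.toLinearEquiv.toLinearMap.restrictScalars ℝ).det ≠ 0 :=
    ((U.toLinearEquiv.restrictScalars ℝ).isUnit_det').ne_zero
  have hmap := Measure.map_linearMap_addHaar_eq_smul_addHaar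
    (volume : Measure (ι → ℂ)) hd
  change Measure.map U volume = _ at hmap
  set c := ENNReal.ofReal |(U.toLinearEquiv.toLinearMap.restrictScalars ℝ).det⁻¹|
  set B := {Z : ι → ℂ | ∑ i, ‖Z i‖ ^ 2 < 1} with hB
  have hBo : IsOpen B := isOpen_sum_norm_sq_lt 1
  have hpre : U ⁻¹' B = B := by
    ext Y
    simp [hB, hU]
  have h0 : volume B ≠ 0 := (hBo.measure_pos volume ⟨0, by simp [hB]⟩).ne'
  have h1 := congrArg (fun μ => μ B) hmap
  simp only [Measure.map_apply U.continuous.measurable hBo.measurableSet, hpre,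
    Measure.smul_apply, smul_eq_mul] at h1
  have hc : c = 1 := by
    have := (ENNReal.mul_left_inj h0 (volume_sum_norm_sq_lt_lt_top 1).ne).1
      ((one_mul _).trans h1)
    exact this.symm
  rw [hmap, hc, one_smul]

lemma exists_unitary_map_single {m : ℕ} (W : Fin (m + 1) → ℂ) :
    ∃ (c : ℂ) (U : (Fin (m + 1) → ℂ) ≃L[ℂ] (Fin (m + 1) → ℂ)),
      (∀ Y, ∑ i, ‖U Y i‖ ^ 2 = ∑ i, ‖Y i‖ ^ 2) ∧
      c • U (Pi.single (Fin.last m) 1) = W ∧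
      ∀ Y, ∑ i, U Y i * (starRingEnd ℂ) (W i) = (starRingEnd ℂ) c * Y (Fin.last m) := by
  obtain ⟨c, v, hv, hW⟩ : ∃ (c : ℂ) (v : EuclideanSpace ℂ (Fin (m + 1))), ‖v‖ = 1 ∧
      c • v = WithLp.toLp 2 W := by
    by_cases h : WithLp.toLp 2 W = 0
    · exact ⟨0, EuclideanSpace.single 0 1, by simp, by simp [h]⟩
    · refine ⟨‖WithLp.toLp 2 W‖, (‖WithLp.toLp 2 W‖ : ℂ)⁻¹ • WithLp.toLp 2 W, ?_, ?_⟩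
      · rw [norm_smul, norm_inv, norm_real, norm_norm, inv_mul_cancel₀ (norm_ne_zero_iff.2 h)]
      · rw [smul_inv_smul₀]
        exact_mod_cast norm_ne_zero_iff.2 h
  obtain ⟨b, hb⟩ := Orthonormal.exists_orthonormalBasis_extension_of_card_eq (𝕜 := ℂ)
    (ι := Fin (m + 1)) (E := EuclideanSpace ℂ (Fin (m + 1))) (by simp) (v := fun _ => v)
    (s := {Fin.last m}) (by simp [hv])
  have hbl : b (Fin.last m) = v := hb _ rfl
  let e := (EuclideanSpace.equiv (Fin (m + 1)) ℂ)
  let U := (e.symm.trans b.repr.symm.toContinuousLinearEquiv).trans e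
  have hUsingle : U (Pi.single (Fin.last m) 1) = e v := by
    simp only [U, ContinuousLinearEquiv.trans_apply]
    congr 1
    rw [← hbl]
    exact b.repr_symm_single (Fin.last m)
  refine ⟨c, U, fun Y => ?_, ?_, fun Y => ?_⟩
  · have h1 := EuclideanSpace.norm_sq_eq (b.repr.symm (e.symm Y))
    have h2 := EuclideanSpace.norm_sq_eq (e.symm Y)
    rw [b.repr.symm.norm_map, h2] at h1
    exact h1.symm
  · rw [hUsingle, ← map_smul, hW]
    rfl
  · have h1 : inner ℂ (WithLp.toLp 2 W) (b.repr.symm (e.symm Y)) =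
        ∑ i, U Y i * (starRingEnd ℂ) (W i) := by
      rw [PiLp.inner_apply]
      rfl
    rw [← h1, ← hW, inner_smul_left, ← hbl, ← b.repr_apply_apply,
      LinearIsometryEquiv.apply_symm_apply]
    rfl

lemma setIntegral_ball_mul_conj_pow {m : ℕ} (k : ℕ) (W : Fin (m + 1) → ℂ) {r : ℝ} (hr : 0 < r)
    {p : (Fin (m + 1) → ℂ) → ℂ} (hp : DifferentiableOn ℂ p {Z | ∑ i, ‖Z i‖ ^ 2 < r})
    (hpi : IntegrableOn p {Z | ∑ i, ‖Z i‖ ^ 2 < r}) :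
    ∫ Z in {Z : Fin (m + 1) → ℂ | ∑ i, ‖Z i‖ ^ 2 < r},
      p Z * (starRingEnd ℂ) ((∑ i, Z i * (starRingEnd ℂ) (W i)) ^ k) =
      ((Real.pi ^ (m + 1) * k.factorial / (m + 1 + k).factorial * r ^ (m + 1 + k) : ℝ) : ℂ) *
        taylorCoeff k (fun t => p (t • W)) := by
  obtain ⟨c, U, hU, hW, hUW⟩ := exists_unitary_map_single W
  set B := {Z : Fin (m + 1) → ℂ | ∑ i, ‖Z i‖ ^ 2 < r} with hB
  have hBm : MeasurableSet B := (isOpen_sum_norm_sq_lt r).measurableSet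
  have hpre : U ⁻¹' B = B := by
    ext Y
    simp [hB, hU]
  have hmp := measurePreserving_of_sum_norm_sq_eq U hU
  have hme : MeasurableEmbedding U := U.toHomeomorph.measurableEmbedding
  have hpU : DifferentiableOn ℂ (fun Y => p (U Y)) B :=
    hp.comp U.differentiable.differentiableOn fun Y hY => by
      rw [← hpre] at hY
      exact hY
  have hpUi : IntegrableOn (fun Y => p (U Y)) B := by
    have := (hmp.integrableOn_comp_preimage hme (f := p) (s := B)).2 hpi
    rwa [hpre] at this
  have key := setIntegral_mul_conj_coord_pow (Fin.last m) k hpU hpUi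
  have hint : ∫ Z in B, ((‖Z (Fin.last m)‖ ^ 2 : ℝ) : ℂ) ^ k =
      ((Real.pi ^ (m + 1) * k.factorial / (m + 1 + k).factorial * r ^ (m + 1 + k) : ℝ) : ℂ) := by
    simp only [← ofReal_pow]
    rw [integral_complex_ofReal, integral_eq_lintegral_of_nonneg_ae (.of_forall fun Z => by positivity)
      (Continuous.aestronglyMeasurable (by fun_prop)), setLIntegral_sum_norm_sq_lt k m hr,
      ENNReal.toReal_ofReal (by positivity)]
  rw [← hmp.setIntegral_preimage_emb hme, hpre]
  simp only [hUW]
  have h1 : ∀ Y, p (U Y) * (starRingEnd ℂ) (((starRingEnd ℂ) c * Y (Fin.last m)) ^ k) =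
      c ^ k * (p (U Y) * (starRingEnd ℂ) (Y (Fin.last m) ^ k)) := by
    intro Y
    simp only [map_pow, map_mul, conj_conj, mul_pow]
    ring
  simp only [h1]
  rw [integral_const_mul, key, hint, ← mul_assoc, ← taylorCoeff_comp_mul, mul_comm]
  congr 3
  ext t
  congr 1
  rw [mul_comm c t, mul_smul, U.map_smul, U.map_smul, hW]

lemma indicator_slice {X Y A : Type*} [Zero A] {D : Set X} {B : X → Set Y} {G : Set (X × Y)}
    (hGB : ∀ x y, (x, y) ∈ G ↔ x ∈ D ∧ y ∈ B x) (f : X × Y → A) {x : X} (hx : x ∈ D) :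
    (fun y => G.indicator f (x, y)) = (B x).indicator fun y => f (x, y) := by
  ext y
  by_cases hy : y ∈ B x
  · rw [Set.indicator_of_mem hy, Set.indicator_of_mem ((hGB x y).2 ⟨hx, hy⟩)]
  · rw [Set.indicator_of_notMem hy, Set.indicator_of_notMem fun h => hy ((hGB x y).1 h).2]

lemma setIntegral_prod_of_slices {X Y : Type*} [MeasurableSpace X] [MeasurableSpace Y] {A : Type*}
    [NormedAddCommGroup A] [NormedSpace ℝ A]
    {μ : Measure X} {ν : Measure Y} [SFinite μ] [SFinite ν] {D : Set X} {B : X → Set Y}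
    (hD : MeasurableSet D) (hB : ∀ x, MeasurableSet (B x)) {G : Set (X × Y)}
    (hG : MeasurableSet G) (hGB : ∀ x y, (x, y) ∈ G ↔ x ∈ D ∧ y ∈ B x) {f : X × Y → A}
    (hf : IntegrableOn f G (μ.prod ν)) :
    (∀ᵐ x ∂μ.restrict D, IntegrableOn (fun y => f (x, y)) (B x) ν) ∧
      IntegrableOn (fun x => ∫ y in B x, f (x, y) ∂ν) D μ ∧
      ∫ p in G, f p ∂(μ.prod ν) = ∫ x in D, ∫ y in B x, f (x, y) ∂ν ∂μ := by
  have hslice : ∀ x ∈ D, (fun y => G.indicator f (x, y)) = (B x).indicator fun y => f (x, y) := by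
    exact fun x hx => indicator_slice hGB f hx
  have hslice' : (fun x => ∫ y, G.indicator f (x, y) ∂ν) =
      D.indicator fun x => ∫ y in B x, f (x, y) ∂ν := by
    ext x
    by_cases hx : x ∈ D
    · rw [hslice x hx, integral_indicator (hB x), Set.indicator_of_mem hx]
    · simp [hGB, hx]
  have hf' := hf.integrable_indicator hG
  refine ⟨?_, ?_, ?_⟩
  · rw [ae_restrict_iff' hD]
    filter_upwards [hf'.prod_right_ae] with x hx hxD
    rw [hslice x hxD, integrable_indicator_iff (hB x)] at hx
    exact hx
  · rw [← integrable_indicator_iff hD, ← hslice']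
    exact hf'.integral_prod_left
  · rw [← integral_indicator hG, integral_prod _ hf', hslice', integral_indicator hD]

lemma integrableOn_prod_of_slices {X Y : Type*} [MeasurableSpace X] [MeasurableSpace Y]
    {μ : Measure X} {ν : Measure Y} [SFinite μ] [SFinite ν] {D : Set X} {B : X → Set Y}
    (hD : MeasurableSet D) (hB : ∀ x, MeasurableSet (B x)) {G : Set (X × Y)}
    (hG : MeasurableSet G) (hGB : ∀ x y, (x, y) ∈ G ↔ x ∈ D ∧ y ∈ B x) {f : X × Y → ℝ}
    (hf0 : ∀ p, 0 ≤ f p) (hfm : AEStronglyMeasurable f ((μ.prod ν).restrict G))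
    (hfs : ∀ x ∈ D, IntegrableOn (fun y => f (x, y)) (B x) ν)
    (hfi : IntegrableOn (fun x => ∫ y in B x, f (x, y) ∂ν) D μ) :
    IntegrableOn f G (μ.prod ν) := by
  have hslice : ∀ x ∈ D, (fun y => G.indicator f (x, y)) = (B x).indicator fun y => f (x, y) := by
    exact fun x hx => indicator_slice hGB f hx
  have hslice' : (fun x => ∫ y, ‖G.indicator f (x, y)‖ ∂ν) =
      D.indicator fun x => ∫ y in B x, f (x, y) ∂ν := by
    ext x
    simp only [Real.norm_of_nonneg (Set.indicator_nonneg (fun p _ => hf0 p) _)]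
    by_cases hx : x ∈ D
    · rw [hslice x hx, integral_indicator (hB x), Set.indicator_of_mem hx]
    · simp [hGB, hx]
  rw [← integrable_indicator_iff hG, integrable_prod_iff ((aestronglyMeasurable_indicator_iff hG).2 hfm), hslice',
    integrable_indicator_iff hD]
  refine ⟨.of_forall fun x => ?_, hfi⟩
  by_cases hx : x ∈ D
  · rw [hslice x hx, integrable_indicator_iff (hB x)]
    exact hfs x hx
  · simp [hGB, hx]

lemma integrableOn_mul_conj_of_sq {X : Type*} [MeasurableSpace X] {μ : Measure X} {f g : X → ℂ}
    (hfm : AEStronglyMeasurable f μ) (hgm : AEStronglyMeasurable g μ)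
    (hf : Integrable (fun x => ‖f x‖ ^ 2) μ) (hg : Integrable (fun x => ‖g x‖ ^ 2) μ) :
    Integrable (fun x => f x * (starRingEnd ℂ) (g x)) μ := by
  refine (hf.add hg).mono' (hfm.mul (continuous_conj.comp_aestronglyMeasurable hgm))
    (.of_forall fun x => ?_)
  simp only [norm_mul, RCLike.norm_conj, Pi.add_apply]
  nlinarith [sq_nonneg (‖f x‖ - ‖g x‖), sq_nonneg (‖f x‖), sq_nonneg (‖g x‖)]

lemma integrable_of_integrable_sq {X : Type*} [MeasurableSpace X] {μ : Measure X}
    [IsFiniteMeasure μ] {f : X → ℂ} (hfm : AEStronglyMeasurable f μ)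
    (hf : Integrable (fun x => ‖f x‖ ^ 2) μ) : Integrable f μ := by
  simpa using integrableOn_mul_conj_of_sq (g := fun _ => 1) hfm aestronglyMeasurable_const hf
    (integrable_const _)

/-- The domain fibred over `D` by the sublevel sets `{Z | N Z < φ z}`. -/
def hartogs {E F : Type*} (D : Set E) (φ : E → ℝ) (N : F → ℝ) : Set (E × F) :=
  {p | p.1 ∈ D ∧ N p.2 < φ p.1}

/-- Integration against `conj (ℓ ^ k)` over the sublevel sets of `N` extracts, up to the factor
`C * r ^ d`, the `k`-th Taylor coefficient along `W`. -/
structure ExtractsTaylorCoeff [MeasurableSpace F] (ν : Measure F) (N : F → ℝ) (ℓ : F →L[ℂ] ℂ)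
    (W : F) (k d : ℕ) (C : ℝ) : Prop where
  continuous : Continuous N
  map_zero : N 0 = 0
  measure_lt_top (r : ℝ) : ν {Z | N Z < r} < ⊤
  bound (r : ℝ) : ∃ A, ∀ Z, N Z < r → ‖ℓ Z‖ ≤ A
  pos : 0 < C
  integral_eq {r : ℝ} (hr : 0 < r) {p : F → ℂ} (hp : DifferentiableOn ℂ p {Z | N Z < r})
    (hpi : IntegrableOn p {Z | N Z < r} ν) :
    ∫ Z in {Z | N Z < r}, p Z * (starRingEnd ℂ) (ℓ Z ^ k) ∂ν =
      ((C * r ^ d : ℝ) : ℂ) * taylorCoeff k fun t => p (t • W)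

lemma isOpen_hartogs {E F : Type*} [TopologicalSpace E] [TopologicalSpace F] {D : Set E}
    {φ : E → ℝ} {N : F → ℝ} (hD : IsOpen D)
    (hφ : ContinuousOn φ D) (hN : Continuous N) : IsOpen (hartogs D φ N) := by
  have h1 : ContinuousOn (fun p : E × F => φ p.1 - N p.2) (D ×ˢ Set.univ) :=
    (hφ.comp continuousOn_fst fun p hp => hp.1).sub (hN.comp continuous_snd).continuousOn
  have := h1.isOpen_inter_preimage (hD.prod isOpen_univ) isOpen_Ioi (t := Set.Ioi 0)
  convert this using 1
  ext p
  simp [hartogs]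

namespace ExtractsTaylorCoeff

variable [MeasurableSpace F] {ν : Measure F} {N : F → ℝ} {ℓ : F →L[ℂ] ℂ} {W : F} {k d : ℕ} {C : ℝ}

lemma isOpen_lt (h : ExtractsTaylorCoeff ν N ℓ W k d C) (r : ℝ) : IsOpen {Z | N Z < r} :=
  _root_.isOpen_lt h.continuous continuous_const

lemma differentiableOn_taylorCoeff [FiniteDimensional ℂ E] [FiniteDimensional ℂ F]
    {D : Set E} {φ : E → ℝ} {g : E × F → ℂ} (h : ExtractsTaylorCoeff ν N ℓ W k d C) (hD : IsOpen D)
    (hφ : ContinuousOn φ D) (hφ0 : ∀ z ∈ D, 0 < φ z)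
    (hg : DifferentiableOn ℂ g (hartogs D φ N)) (j : ℕ) :
    DifferentiableOn ℂ (fun z => taylorCoeff j fun t => g (z, t • W)) D :=
  _root_.differentiableOn_taylorCoeff (isOpen_hartogs hD hφ h.continuous)
    (fun z hz => ⟨hz, by simpa [h.map_zero] using hφ0 z hz⟩) hg W j

variable [FiniteDimensional ℂ F] [BorelSpace F]

lemma integrableOn_pow (h : ExtractsTaylorCoeff ν N ℓ W k d C) (r : ℝ) :
    IntegrableOn (fun Z => ℓ Z ^ k) {Z | N Z < r} ν := by
  obtain ⟨A, hA⟩ := h.bound r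
  have : IsFiniteMeasure (ν.restrict {Z | N Z < r}) := ⟨by simpa using h.measure_lt_top r⟩
  refine Integrable.of_bound (C := A ^ k) (Continuous.aestronglyMeasurable (by fun_prop)) ?_
  refine (ae_restrict_iff' (h.isOpen_lt r).measurableSet).2 (.of_forall fun Z hZ => ?_)
  rw [norm_pow]
  gcongr
  exact hA Z hZ

lemma integrableOn_sq (h : ExtractsTaylorCoeff ν N ℓ W k d C) (r : ℝ) :
    IntegrableOn (fun Z => ‖ℓ Z ^ k‖ ^ 2) {Z | N Z < r} ν := by
  obtain ⟨A, hA⟩ := h.bound r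
  have : IsFiniteMeasure (ν.restrict {Z | N Z < r}) := ⟨by simpa using h.measure_lt_top r⟩
  refine Integrable.of_bound (C := (A ^ k) ^ 2) (Continuous.aestronglyMeasurable (by fun_prop)) ?_
  refine (ae_restrict_iff' (h.isOpen_lt r).measurableSet).2 (.of_forall fun Z hZ => ?_)
  rw [norm_pow, norm_norm, norm_pow]
  gcongr
  exact hA Z hZ

lemma integral_sq (h : ExtractsTaylorCoeff ν N ℓ W k d C) {r : ℝ} (hr : 0 < r) :
    ∫ Z in {Z | N Z < r}, ‖ℓ Z ^ k‖ ^ 2 ∂ν = C * r ^ d * (ℓ W ^ k).re := by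
  have h1 := h.integral_eq hr (p := fun Z => ℓ Z ^ k)
    (ℓ.differentiable.pow k).differentiableOn (h.integrableOn_pow r)
  have h2 : ∀ t : ℂ, ℓ (t • W) ^ k = (ℓ W * t) ^ k := fun t => by
    rw [map_smul, smul_eq_mul, mul_comm]
  simp only [h2, taylorCoeff_const_mul_pow, mul_conj, normSq_eq_norm_sq] at h1
  rw [integral_complex_ofReal] at h1
  rw [← ofReal_re (∫ Z in {Z | N Z < r}, ‖ℓ Z ^ k‖ ^ 2 ∂ν), h1, re_ofReal_mul]

variable [MeasurableSpace E] [BorelSpace E] {β : Measure E} [SFinite β] [SFinite ν]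
  {D : Set E} {φ : E → ℝ} {g : E × F → ℂ}

lemma ae_slice (h : ExtractsTaylorCoeff ν N ℓ W k d C) (hD : IsOpen D) (hφ : ContinuousOn φ D)
    (hφ0 : ∀ z ∈ D, 0 < φ z) (hg : DifferentiableOn ℂ g (hartogs D φ N))
    (hgi : IntegrableOn (fun p => ‖g p‖ ^ 2) (hartogs D φ N) (β.prod ν)) :
    ∀ᵐ z ∂β.restrict D, IntegrableOn (fun Z => ‖g (z, Z)‖ ^ 2) {Z | N Z < φ z} ν ∧
      ∫ Z in {Z | N Z < φ z}, g (z, Z) * (starRingEnd ℂ) (ℓ Z ^ k) ∂ν =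
      ((C * φ z ^ d : ℝ) : ℂ) * taylorCoeff k fun t => g (z, t • W) := by
  have hG := isOpen_hartogs hD hφ h.continuous
  obtain ⟨h1, -⟩ := setIntegral_prod_of_slices hD.measurableSet
    (fun z => (h.isOpen_lt (φ z)).measurableSet) hG.measurableSet (fun z Z => Iff.rfl) hgi
  filter_upwards [h1, ae_restrict_mem hD.measurableSet] with z hz hzD
  have : IsFiniteMeasure (ν.restrict {Z | N Z < φ z}) := ⟨by simpa using h.measure_lt_top (φ z)⟩
  have hd : DifferentiableOn ℂ (fun Z => g (z, Z)) {Z | N Z < φ z} :=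
    hg.comp (by fun_prop) fun Z hZ => ⟨hzD, hZ⟩
  exact ⟨hz, h.integral_eq (hφ0 z hzD) hd (integrable_of_integrable_sq
    (hd.continuousOn.aestronglyMeasurable (h.isOpen_lt _).measurableSet) hz)⟩

lemma integrableOn_taylorCoeff_sq [FiniteDimensional ℂ E]
    (h : ExtractsTaylorCoeff ν N ℓ W k d C) (hD : IsOpen D)
    (hφ : ContinuousOn φ D) (hφ0 : ∀ z ∈ D, 0 < φ z) (hg : DifferentiableOn ℂ g (hartogs D φ N))
    (hgi : IntegrableOn (fun p => ‖g p‖ ^ 2) (hartogs D φ N) (β.prod ν)) :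
    IntegrableOn (fun z => ‖taylorCoeff k fun t => g (z, t • W)‖ ^ 2 * φ z ^ d) D β := by
  have hG := isOpen_hartogs hD hφ h.continuous
  set a := fun z => taylorCoeff k fun t => g (z, t • W)
  have ha := h.differentiableOn_taylorCoeff hD hφ hφ0 hg k
  obtain ⟨-, h2, -⟩ := setIntegral_prod_of_slices hD.measurableSet
    (fun z => (h.isOpen_lt (φ z)).measurableSet) hG.measurableSet (fun z Z => Iff.rfl) hgi
  set M := |(ℓ W ^ k).re| + 1 with hM
  have hM0 : 0 < M := by positivity
  have hMle : (ℓ W ^ k).re ≤ M := (le_abs_self _).trans (by simp [hM])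
  refine (h2.const_mul (M / C)).mono' ?_ ?_
  · exact ((ha.continuousOn.norm.pow 2).mul (hφ.pow d)).aestronglyMeasurable hD.measurableSet
  filter_upwards [h.ae_slice hD hφ hφ0 hg hgi, ae_restrict_mem hD.measurableSet] with z hz hzD
  obtain ⟨hz1, hz2⟩ := hz
  have hφz := hφ0 z hzD
  have hC := h.pos
  rw [Real.norm_of_nonneg (by positivity)]
  have h3 : C * φ z ^ d * ‖a z‖ ^ 2 ≤ ∫ Z in {Z | N Z < φ z},
      (M * ‖g (z, Z)‖ ^ 2 + M⁻¹ * ‖a z‖ ^ 2 * ‖ℓ Z ^ k‖ ^ 2) / 2 ∂ν := by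
    have h4 : ((C * φ z ^ d : ℝ) : ℂ) * (a z * (starRingEnd ℂ) (a z)) =
        ∫ Z in {Z | N Z < φ z}, g (z, Z) * (starRingEnd ℂ) (a z * ℓ Z ^ k) ∂ν := by
      rw [← mul_assoc, ← hz2, ← integral_mul_const]
      congr 1
      ext Z
      rw [map_mul]
      ring
    have h5 : C * φ z ^ d * ‖a z‖ ^ 2 =
        ‖((C * φ z ^ d : ℝ) : ℂ) * (a z * (starRingEnd ℂ) (a z))‖ := by
      rw [norm_mul, norm_mul, RCLike.norm_conj, norm_real, Real.norm_of_nonneg (by positivity)]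
      ring
    rw [h5, h4]
    refine norm_integral_le_of_norm_le
      (((hz1.const_mul M).add ((h.integrableOn_sq (φ z)).const_mul (M⁻¹ * ‖a z‖ ^ 2))).div_const 2)
      (.of_forall fun Z => ?_)
    rw [norm_mul, RCLike.norm_conj, norm_mul]
    have h6 := sq_nonneg (M * ‖g (z, Z)‖ - ‖a z‖ * ‖ℓ Z ^ k‖)
    have h7 : (M * ‖g (z, Z)‖ ^ 2 + M⁻¹ * ‖a z‖ ^ 2 * ‖ℓ Z ^ k‖ ^ 2) / 2 -
        ‖g (z, Z)‖ * (‖a z‖ * ‖ℓ Z ^ k‖) =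
        M⁻¹ / 2 * (M * ‖g (z, Z)‖ - ‖a z‖ * ‖ℓ Z ^ k‖) ^ 2 := by
      field_simp
      ring
    have h8 : 0 ≤ M⁻¹ / 2 * (M * ‖g (z, Z)‖ - ‖a z‖ * ‖ℓ Z ^ k‖) ^ 2 := by positivity
    linarith
  rw [integral_div, integral_add (hz1.const_mul M)
    ((h.integrableOn_sq (φ z)).const_mul (M⁻¹ * ‖a z‖ ^ 2)), integral_const_mul,
    integral_const_mul, h.integral_sq hφz] at h3
  have h9 : M⁻¹ * (ℓ W ^ k).re ≤ 1 := by
    rw [inv_mul_le_iff₀ hM0]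
    linarith
  have h10 : M⁻¹ * ‖a z‖ ^ 2 * (C * φ z ^ d * (ℓ W ^ k).re) ≤ C * φ z ^ d * ‖a z‖ ^ 2 := by
    calc _ = (C * φ z ^ d * ‖a z‖ ^ 2) * (M⁻¹ * (ℓ W ^ k).re) := by ring
      _ ≤ _ := mul_le_of_le_one_right (by positivity) h9
  rw [div_mul_eq_mul_div, le_div_iff₀ hC]
  change ‖a z‖ ^ 2 * φ z ^ d * C ≤ _
  linarith

lemma mul_pow_eq_integral [FiniteDimensional ℂ E]
    (h : ExtractsTaylorCoeff ν N ℓ W k d C) (hD : IsOpen D)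
    (hφ : ContinuousOn φ D) (hφ0 : ∀ z ∈ D, 0 < φ z) (hg : DifferentiableOn ℂ g (hartogs D φ N))
    (hgi : IntegrableOn (fun p => ‖g p‖ ^ 2) (hartogs D φ N) (β.prod ν)) {w : E}
    (hrep : ∀ f : E × F → ℂ, DifferentiableOn ℂ f (hartogs D φ N) →
      IntegrableOn (fun p => ‖f p‖ ^ 2) (hartogs D φ N) (β.prod ν) →
      f (w, W) = ∫ p in hartogs D φ N, f p * (starRingEnd ℂ) (g p) ∂(β.prod ν))
    {b : E → ℂ} (hb : DifferentiableOn ℂ b D)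
    (hbi : IntegrableOn (fun z => ‖b z‖ ^ 2 * φ z ^ d) D β) :
    b w * ℓ W ^ k = C * ∫ z in D, b z * (starRingEnd ℂ) (taylorCoeff k fun t => g (z, t • W)) *
      ((φ z ^ d : ℝ) : ℂ) ∂β := by
  have hG := isOpen_hartogs hD hφ h.continuous
  have hBm := fun z => (h.isOpen_lt (φ z)).measurableSet
  set s : E × F → ℂ := fun p => b p.1 * ℓ p.2 ^ k with hs
  have hsd : DifferentiableOn ℂ s (hartogs D φ N) :=
    (hb.comp differentiableOn_fst fun p hp => hp.1).mul
      ((ℓ.differentiable.comp differentiable_snd).pow k).differentiableOn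
  have hsi : IntegrableOn (fun p => ‖s p‖ ^ 2) (hartogs D φ N) (β.prod ν) := by
    refine integrableOn_prod_of_slices hD.measurableSet hBm hG.measurableSet
      (fun z Z => Iff.rfl) (fun p => by positivity)
      ((hsd.continuousOn.norm.pow 2).aestronglyMeasurable hG.measurableSet) ?_ ?_
    · intro z hz
      simp only [hs, norm_mul, mul_pow]
      exact (h.integrableOn_sq (φ z)).const_mul _
    · refine (hbi.mul_const (C * (ℓ W ^ k).re)).congr ?_
      filter_upwards [ae_restrict_mem hD.measurableSet] with z hz
      simp only [hs, norm_mul, mul_pow]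
      rw [integral_const_mul, h.integral_sq (hφ0 z hz)]
      ring
  have hsg := integrableOn_mul_conj_of_sq
    (hsd.continuousOn.aestronglyMeasurable hG.measurableSet)
    (hg.continuousOn.aestronglyMeasurable hG.measurableSet) hsi hgi
  obtain ⟨-, -, h1⟩ := setIntegral_prod_of_slices hD.measurableSet hBm hG.measurableSet
    (fun z Z => Iff.rfl) hsg
  have h2 := hrep s hsd hsi
  rw [h1] at h2
  refine h2.trans ?_
  rw [← integral_const_mul]
  refine integral_congr_ae ?_
  filter_upwards [h.ae_slice hD hφ hφ0 hg hgi] with z hz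
  have h3 : ∀ Z, s (z, Z) * (starRingEnd ℂ) (g (z, Z)) =
      b z * (starRingEnd ℂ) (g (z, Z) * (starRingEnd ℂ) (ℓ Z ^ k)) := by
    intro Z
    simp only [hs, map_mul, conj_conj]
    ring
  simp only [h3]
  rw [integral_const_mul, integral_conj, hz.2, map_mul, conj_ofReal]
  push_cast
  ring

end ExtractsTaylorCoeff

lemma extractsTaylorCoeff_pi (M k : ℕ) (W : Fin (M + 1) → ℂ) :
    ExtractsTaylorCoeff
      (ENNReal.ofReal (((M + 1).factorial : ℝ) / Real.pi ^ (M + 1)) •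
        (volume : Measure (Fin (M + 1) → ℂ)))
      (fun Z => ∑ i, ‖Z i‖ ^ 2)
      (∑ i, (starRingEnd ℂ) (W i) • ContinuousLinearMap.proj (R := ℂ) (φ := fun _ => ℂ) i) W k
      (M + k + 1) ((M + 1).factorial * k.factorial / (M + k + 1).factorial) where
  continuous := by fun_prop
  map_zero := by simp
  measure_lt_top r := by
    rw [Measure.smul_apply, smul_eq_mul]
    exact ENNReal.mul_lt_top ENNReal.ofReal_lt_top (volume_sum_norm_sq_lt_lt_top r)
  bound r := by
    set ℓ := ∑ i, (starRingEnd ℂ) (W i) •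
      ContinuousLinearMap.proj (R := ℂ) (φ := fun _ : Fin (M + 1) => ℂ) i
    refine ⟨‖ℓ‖ * √r, fun Z hZ => (ℓ.le_opNorm Z).trans ?_⟩
    gcongr
    rw [pi_norm_le_iff_of_nonneg (Real.sqrt_nonneg _)]
    intro i
    apply Real.le_sqrt_of_sq_le
    exact (Finset.single_le_sum (fun j _ => sq_nonneg ‖Z j‖) (Finset.mem_univ i)).trans hZ.le
  pos := by positivity
  integral_eq {r} hr {p} hp hpi := by
    have hc : 0 < ((M + 1).factorial : ℝ) / Real.pi ^ (M + 1) := by positivity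
    have hpi' : IntegrableOn p {Z : Fin (M + 1) → ℂ | ∑ i, ‖Z i‖ ^ 2 < r} := by
      rw [IntegrableOn, Measure.restrict_smul, integrable_smul_measure
        (ENNReal.ofReal_pos.2 hc).ne' ENNReal.ofReal_ne_top] at hpi
      exact hpi
    have key := setIntegral_ball_mul_conj_pow k W hr hp hpi'
    rw [Measure.restrict_smul, integral_smul_measure, ENNReal.toReal_ofReal hc.le]
    simp only [_root_.sum_apply, _root_.smul_apply,
      ContinuousLinearMap.proj_apply, smul_eq_mul, mul_comm ((starRingEnd ℂ) (W _))]
    rw [key, real_smul, ← mul_assoc, ← ofReal_mul, show M + 1 + k = M + k + 1 by ring]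
    congr 2
    field_simp

lemma extractsTaylorCoeff_complex (k : ℕ) (η : ℂ) :
    ExtractsTaylorCoeff (ENNReal.ofReal (1 / Real.pi) • (volume : Measure ℂ))
      (fun ζ => ‖ζ‖ ^ 2) ((starRingEnd ℂ) η • ContinuousLinearMap.id ℂ ℂ) η k
      (k + 1) (1 / (k + 1)) := by
  have hpre : ∀ r, (fun Z : Fin 1 → ℂ => Z 0) ⁻¹' {ζ : ℂ | ‖ζ‖ ^ 2 < r} =
      {Z : Fin 1 → ℂ | ∑ i, ‖Z i‖ ^ 2 < r} := by
    intro r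
    ext Z
    simp
  have hmp : MeasurePreserving (fun Z : Fin 1 → ℂ => Z 0) := by
    convert volume_preserving_funUnique (Fin 1) ℂ <;> rfl
  have hme : MeasurableEmbedding (fun Z : Fin 1 → ℂ => Z 0) :=
    (MeasurableEquiv.funUnique (Fin 1) ℂ).measurableEmbedding
  have hfib := extractsTaylorCoeff_pi 0 k fun _ => η
  have hmp' : MeasurePreserving (fun Z : Fin 1 → ℂ => Z 0)
      (ENNReal.ofReal (((0 + 1).factorial : ℝ) / Real.pi ^ (0 + 1)) • volume)
      (ENNReal.ofReal (1 / Real.pi) • volume) := by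
    simpa using hmp.smul_measure (ENNReal.ofReal (1 / Real.pi))
  exact
  { continuous := by fun_prop
    map_zero := by simp
    measure_lt_top r := by
      have := hfib.measure_lt_top r
      rwa [← hpre, hmp'.measure_preimage_emb hme] at this
    bound r := by
      obtain ⟨A, hA⟩ := hfib.bound r
      exact ⟨A, fun ζ hζ => by simpa using hA (fun _ => ζ) (by simpa using hζ)⟩
    pos := by positivity
    integral_eq {r} hr {p} hp hpi := by
      have hp' : DifferentiableOn ℂ (fun Z : Fin 1 → ℂ => p (Z 0))
          {Z : Fin 1 → ℂ | ∑ i, ‖Z i‖ ^ 2 < r} :=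
        hp.comp (by fun_prop) fun Z hZ => by
          rw [← hpre] at hZ
          exact hZ
      have hpi' := (hmp'.integrableOn_comp_preimage hme (f := p)).2 hpi
      rw [hpre] at hpi'
      have key := hfib.integral_eq hr hp' hpi'
      rw [← hmp'.setIntegral_preimage_emb hme, hpre]
      refine Eq.trans (integral_congr_ae (.of_forall fun Z => ?_)) (key.trans ?_)
      · simp
      · rw [zero_add k, Nat.factorial_succ k]
        have := Nat.factorial_ne_zero k
        congr 3
        push_cast
        simp
        field_simp }

namespace ExtractsTaylorCoeff

variable {F' : Type*} [NormedAddCommGroup F'] [NormedSpace ℂ F'] [FiniteDimensional ℂ F']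
  [FiniteDimensional ℂ E] [FiniteDimensional ℂ F] [MeasurableSpace F] [BorelSpace F] [MeasurableSpace F'] [BorelSpace F']
  [MeasurableSpace E] [BorelSpace E]

lemma taylorCoeff_mul_eq_conj {ν : Measure F} {N : F → ℝ} {ℓ : F →L[ℂ] ℂ} {W : F} {k d : ℕ} {C : ℝ}
    (h : ExtractsTaylorCoeff ν N ℓ W k d C)
    {ν' : Measure F'} {N' : F' → ℝ} {ℓ' : F' →L[ℂ] ℂ} {W' : F'} {k' : ℕ} {C' : ℝ}
    (h' : ExtractsTaylorCoeff ν' N' ℓ' W' k' d C')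
    {β : Measure E} [SFinite β] [SFinite ν] [SFinite ν']
    {D : Set E} {φ : E → ℝ} (hD : IsOpen D) (hφ : ContinuousOn φ D) (hφ0 : ∀ z ∈ D, 0 < φ z)
    {w : E} {g : E × F → ℂ} {g' : E × F' → ℂ}
    (hg : DifferentiableOn ℂ g (hartogs D φ N))
    (hgi : IntegrableOn (fun p => ‖g p‖ ^ 2) (hartogs D φ N) (β.prod ν))
    (hrep : ∀ f : E × F → ℂ, DifferentiableOn ℂ f (hartogs D φ N) →
      IntegrableOn (fun p => ‖f p‖ ^ 2) (hartogs D φ N) (β.prod ν) →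
      f (w, W) = ∫ p in hartogs D φ N, f p * (starRingEnd ℂ) (g p) ∂(β.prod ν))
    (hg' : DifferentiableOn ℂ g' (hartogs D φ N'))
    (hgi' : IntegrableOn (fun p => ‖g' p‖ ^ 2) (hartogs D φ N') (β.prod ν'))
    (hrep' : ∀ f : E × F' → ℂ, DifferentiableOn ℂ f (hartogs D φ N') →
      IntegrableOn (fun p => ‖f p‖ ^ 2) (hartogs D φ N') (β.prod ν') →
      f (w, W') = ∫ p in hartogs D φ N', f p * (starRingEnd ℂ) (g' p) ∂(β.prod ν')) :
    C' * ((taylorCoeff k' fun t => g' (w, t • W')) * ℓ W ^ k) =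
      C * (starRingEnd ℂ) ((taylorCoeff k fun t => g (w, t • W)) * ℓ' W' ^ k') := by
  rw [h.mul_pow_eq_integral hD hφ hφ0 hg hgi hrep
      (h'.differentiableOn_taylorCoeff hD hφ hφ0 hg' k')
      (h'.integrableOn_taylorCoeff_sq hD hφ hφ0 hg' hgi'),
    h'.mul_pow_eq_integral hD hφ hφ0 hg' hgi' hrep'
      (h.differentiableOn_taylorCoeff hD hφ hφ0 hg k)
      (h.integrableOn_taylorCoeff_sq hD hφ hφ0 hg hgi), map_mul, ← integral_conj]
  simp only [map_mul, conj_conj, conj_ofReal]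
  rw [mul_left_comm]
  congr 3
  ext z
  ring

end ExtractsTaylorCoeff

lemma hasSum_derivWithin_of_hasSum {c : ℕ → ℝ} {f : ℝ → ℝ} {R : ℝ}
    (hf : ∀ r, 0 ≤ r → r < R → HasSum (fun j => c j * r ^ j) (f r)) {r : ℝ} (hr : 0 ≤ r)
    (hrR : r < R) :
    HasSum (fun j => (j + 1) * c (j + 1) * r ^ j) (derivWithin f (Set.Ici 0) r) := by
  obtain ⟨s, hrs, hsR⟩ := exists_between hrR
  obtain ⟨t, hst, htR⟩ := exists_between hsR
  have hs : 0 < s := hr.trans_lt hrs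
  have ht : 0 < t := hs.trans hst
  have hgeo : Summable fun j : ℕ => (j : ℝ) ^ 1 * (s / t) ^ j :=
    summable_pow_mul_geometric_of_norm_lt_one 1 (by
      rw [Real.norm_of_nonneg (by positivity)]
      exact (div_lt_one ht).2 hst)
  obtain ⟨M, hM⟩ := (hf t ht.le htR).summable.tendsto_atTop_zero.norm.bddAbove_range
  have hM' : ∀ j, |c j| * t ^ j ≤ M := fun j => by
    have : ‖c j * t ^ j‖ ≤ M := hM ⟨j, rfl⟩
    rwa [norm_mul, norm_pow, Real.norm_eq_abs, Real.norm_of_nonneg ht.le] at this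
  have hu : Summable fun j : ℕ => M / s * ((j : ℝ) ^ 1 * (s / t) ^ j) := hgeo.mul_left _
  have hbound : ∀ j : ℕ, ∀ y ∈ Metric.ball (0 : ℝ) s,
      ‖c j * (j * y ^ (j - 1))‖ ≤ M / s * ((j : ℝ) ^ 1 * (s / t) ^ j) := by
    intro j y hy
    rw [mem_ball_zero_iff, Real.norm_eq_abs] at hy
    rcases j with - | j
    · simp
    · rw [Real.norm_eq_abs, abs_mul, abs_mul, abs_pow, Nat.abs_cast, Nat.add_sub_cancel]
      have h1 : |y| ^ j ≤ s ^ j := by gcongr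
      calc |c (j + 1)| * (((j + 1 : ℕ) : ℝ) * |y| ^ j)
          ≤ |c (j + 1)| * (((j + 1 : ℕ) : ℝ) * s ^ j) := by gcongr
        _ = (|c (j + 1)| * t ^ (j + 1)) * (((j + 1 : ℕ) : ℝ) * s ^ j / t ^ (j + 1)) := by
          field_simp
        _ ≤ M * (((j + 1 : ℕ) : ℝ) * s ^ j / t ^ (j + 1)) := by
          gcongr
          exact hM' _
        _ = _ := by
          rw [div_pow]
          field_simp
          ring
  have hrmem : r ∈ Metric.ball (0 : ℝ) s := by simpa [abs_of_nonneg hr] using hrs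
  have hderiv := hasDerivAt_tsum_of_isPreconnected hu Metric.isOpen_ball
    (convex_ball (0 : ℝ) s).isPreconnected (g := fun j x => c j * x ^ j)
    (fun j y _ => (hasDerivAt_pow j y).const_mul (c j)) hbound hrmem (hf r hr hrR).summable hrmem
  have hd : HasDerivWithinAt f (∑' j, c j * (j * r ^ (j - 1))) (Set.Ici 0) r := by
    refine hderiv.hasDerivWithinAt.congr_of_eventuallyEq ?_ (hf r hr hrR).tsum_eq.symm
    filter_upwards [self_mem_nhdsWithin, mem_nhdsWithin_of_mem_nhds (Iio_mem_nhds hrR)] with y h0 hR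
    exact (hf y h0 hR).tsum_eq.symm
  rw [hd.derivWithin (uniqueDiffOn_Ici 0 r hr)]
  have hsum : Summable fun j : ℕ => c j * (j * r ^ (j - 1)) :=
    hu.of_norm_bounded fun j => hbound j r hrmem
  have := (hasSum_nat_add_iff' 1).2 hsum.hasSum
  simp only [Finset.range_one, Finset.sum_singleton, Nat.cast_zero, zero_mul, mul_zero,
    sub_zero, Nat.add_sub_cancel] at this
  have heq : (fun j : ℕ => (j + 1) * c (j + 1) * r ^ j) =
      fun j : ℕ => c (j + 1) * (((j + 1 : ℕ) : ℝ) * r ^ j) := by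
    ext j
    push_cast
    ring
  rwa [heq]

lemma hasSum_iteratedDerivWithin_of_hasSum (N : ℕ) {c : ℕ → ℝ} {f : ℝ → ℝ} {R : ℝ}
    (hf : ∀ r, 0 ≤ r → r < R → HasSum (fun j => c j * r ^ j) (f r)) {r : ℝ} (hr : 0 ≤ r)
    (hrR : r < R) :
    HasSum (fun k => ((N + k).factorial / k.factorial : ℝ) * c (N + k) * r ^ k)
      (iteratedDerivWithin N f (Set.Ici 0) r) := by
  induction N generalizing c f with
  | zero => simpa [Nat.factorial_ne_zero] using hf r hr hrR
  | succ N ih =>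
    rw [iteratedDerivWithin_succ']
    convert ih fun r hr hrR => hasSum_derivWithin_of_hasSum hf hr hrR using 2 with k
    rw [show N + 1 + k = N + k + 1 by ring, Nat.factorial_succ]
    push_cast
    ring

lemma hasSum_taylorCoeff_hartogs {D : Set E} {φ : E → ℝ} {N : F → ℝ}
    (hN : ∀ (t : ℂ) Z, N (t • Z) = ‖t‖ ^ 2 * N Z) (hN0 : ∀ Z, 0 ≤ N Z) {g : E × F → ℂ}
    (hg : DifferentiableOn ℂ g (hartogs D φ N)) {w : E} {W : F}
    (hq : (w, W) ∈ hartogs D φ N) :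
    HasSum (fun k => taylorCoeff k fun t => g (w, t • W)) (g (w, W)) := by
  have hq2 : N W < φ w := hq.2
  have hcont : Filter.Tendsto (fun R : ℝ => R ^ 2 * N W) (nhdsWithin 1 (Set.Ioi 1))
      (nhds (N W)) := by
    have : ContinuousAt (fun R : ℝ => R ^ 2 * N W) 1 := by fun_prop
    simpa [ContinuousAt] using this.mono_left nhdsWithin_le_nhds
  obtain ⟨R, hR, hR1⟩ := ((hcont.eventually_lt_const hq2).and self_mem_nhdsWithin).exists
  have hd : DifferentiableOn ℂ (fun t : ℂ => g (w, t • W)) (Metric.ball 0 R) := by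
    refine hg.comp (by fun_prop) fun t ht => ⟨hq.1, ?_⟩
    rw [mem_ball_zero_iff] at ht
    have : ‖t‖ ^ 2 * N W ≤ R ^ 2 * N W := by
      have := hN0 W
      gcongr
    change N (t • W) < φ w
    rw [hN]
    linarith
  simpa using hasSum_taylorCoeff hR1 hd

/-- **Principle of inflation.**  Let `D ⊂ ℂⁿ` be a bounded domain, `φ` a bounded positive
continuous function on `D`, and `β = ρ·Lebesgue` a measure with positive continuous
density on `D`.  Let `Ω = {(z,ζ) : z ∈ D, |ζ|² < φ(z)}` with measure
`μ_Ω = β ⊗ (1/π)·Lebesgue` and `G = {(z,Z) : z ∈ D, ‖Z‖² < φ(z)} ⊂ D × ℂ^m` with measure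
`μ_G = β ⊗ (m!/π^m)·Lebesgue`.  If `K_Ω`, `K_G` are the Bergman (reproducing) kernels of
`A²(Ω,μ_Ω)`, `A²(G,μ_G)` and `K_Ω((z,ζ),(z,ζ)) = L(z,|ζ|²)` with `r ↦ L(z,r)` being
`m-1` times differentiable on `[0,∞)`, then
`K_G((z,Z),(z,Z)) = (1/m!)·(∂^{m-1}L/∂r^{m-1})(z,‖Z‖²)`. -/
theorem principle_of_inflation (n m : ℕ) (hm : 0 < m)
    (D : Set (Fin n → ℂ)) (hDopen : IsOpen D) (hDconn : IsConnected D)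
    (hDbdd : Bornology.IsBounded D)
    (φ : (Fin n → ℂ) → ℝ) (hφcont : ContinuousOn φ D) (hφpos : ∀ z ∈ D, 0 < φ z)
    (hφbdd : ∃ M : ℝ, ∀ z ∈ D, φ z ≤ M)
    (ρ : (Fin n → ℂ) → ℝ) (hρcont : ContinuousOn ρ D) (hρpos : ∀ z ∈ D, 0 < ρ z)
    (Ω : Set ((Fin n → ℂ) × ℂ))
    (hΩ : Ω = {p : (Fin n → ℂ) × ℂ | p.1 ∈ D ∧ ‖p.2‖ ^ 2 < φ p.1})
    (G : Set ((Fin n → ℂ) × (Fin m → ℂ)))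
    (hG : G = {p : (Fin n → ℂ) × (Fin m → ℂ) | p.1 ∈ D ∧ ∑ i, ‖p.2 i‖ ^ 2 < φ p.1})
    (μΩ : Measure ((Fin n → ℂ) × ℂ))
    (hμΩ : μΩ = (((volume.withDensity fun z => ENNReal.ofReal (ρ z))).prod
      (ENNReal.ofReal (1 / Real.pi) • volume)).restrict Ω)
    (μG : Measure ((Fin n → ℂ) × (Fin m → ℂ)))
    (hμG : μG = (((volume.withDensity fun z => ENNReal.ofReal (ρ z))).prod
      (ENNReal.ofReal ((m.factorial : ℝ) / Real.pi ^ m) • volume)).restrict G)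
    (KΩ : ((Fin n → ℂ) × ℂ) → ((Fin n → ℂ) × ℂ) → ℂ)
    (KG : ((Fin n → ℂ) × (Fin m → ℂ)) → ((Fin n → ℂ) × (Fin m → ℂ)) → ℂ)
    -- K_Ω(·,q) belongs to the Bergman space A²(Ω,μ_Ω) for each q ∈ Ω
    (hKΩmem : ∀ q ∈ Ω, DifferentiableOn ℂ (fun p => KΩ p q) Ω ∧
      Integrable (fun p => ‖KΩ p q‖ ^ 2) μΩ)
    -- K_Ω reproduces every f ∈ A²(Ω,μ_Ω)
    (hKΩrep : ∀ f : ((Fin n → ℂ) × ℂ) → ℂ, DifferentiableOn ℂ f Ω →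
      Integrable (fun p => ‖f p‖ ^ 2) μΩ →
      ∀ q ∈ Ω, f q = ∫ p, f p * (starRingEnd ℂ) (KΩ p q) ∂μΩ)
    -- K_G(·,q) belongs to the Bergman space A²(G,μ_G) for each q ∈ G
    (hKGmem : ∀ q ∈ G, DifferentiableOn ℂ (fun p => KG p q) G ∧
      Integrable (fun p => ‖KG p q‖ ^ 2) μG)
    -- K_G reproduces every f ∈ A²(G,μ_G)
    (hKGrep : ∀ f : ((Fin n → ℂ) × (Fin m → ℂ)) → ℂ, DifferentiableOn ℂ f G →
      Integrable (fun p => ‖f p‖ ^ 2) μG →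
      ∀ q ∈ G, f q = ∫ p, f p * (starRingEnd ℂ) (KG p q) ∂μG)
    (L : (Fin n → ℂ) → ℝ → ℝ)
    (hLdiff : ∀ z ∈ D, ContDiffOn ℝ (m - 1 : ℕ) (L z) (Set.Ici (0 : ℝ)))
    (hLK : ∀ p ∈ Ω, KΩ p p = ((L p.1 (‖p.2‖ ^ 2) : ℝ) : ℂ)) :
    ∀ p ∈ G, KG p p =
      (((1 / (m.factorial : ℝ)) *
        iteratedDerivWithin (m - 1) (L p.1) (Set.Ici (0 : ℝ)) (∑ i, ‖p.2 i‖ ^ 2) : ℝ) : ℂ) := by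
  obtain ⟨M, rfl⟩ := Nat.exists_eq_succ_of_ne_zero hm.ne'
  change Ω = hartogs D φ fun ζ => ‖ζ‖ ^ 2 at hΩ
  change G = hartogs D φ fun Z => ∑ i, ‖Z i‖ ^ 2 at hG
  subst hΩ hG hμΩ hμG
  rintro ⟨w, W⟩ hq
  have hw : w ∈ D := hq.1
  have hWφ : ∑ i, ‖W i‖ ^ 2 < φ w := hq.2
  have hmemΩ : ∀ {η : ℂ}, ‖η‖ ^ 2 < φ w → (w, η) ∈ hartogs D φ fun ζ : ℂ => ‖ζ‖ ^ 2 :=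
    fun h => ⟨hw, h⟩
  set b : ℂ → ℕ → ℂ := fun η j => taylorCoeff j fun t => KΩ (w, t • η) (w, η) with hb
  obtain ⟨η₀, hη₀, hη₀φ⟩ : ∃ η₀ : ℂ, η₀ ≠ 0 ∧ ‖η₀‖ ^ 2 < φ w := by
    have := hφpos w hw
    refine ⟨(√(φ w / 2) : ℝ), by simpa using (Real.sqrt_pos.2 (half_pos this)).ne', ?_⟩
    rw [norm_real, Real.norm_of_nonneg (Real.sqrt_nonneg _), Real.sq_sqrt (by positivity)]
    linarith
  have hη₀' : ‖η₀‖ ≠ 0 := norm_ne_zero_iff.2 hη₀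
  have hℓ : ∀ η : ℂ, ((starRingEnd ℂ) η • ContinuousLinearMap.id ℂ ℂ) η =
      ((‖η‖ ^ 2 : ℝ) : ℂ) := fun η => by
    simp [mul_comm _ η, mul_conj, normSq_eq_norm_sq]
  have hℓW : (∑ i, (starRingEnd ℂ) (W i) •
      ContinuousLinearMap.proj (R := ℂ) (φ := fun _ => ℂ) i) W =
      ((∑ i, ‖W i‖ ^ 2 : ℝ) : ℂ) := by
    simp [mul_comm _ (W _), mul_conj, normSq_eq_norm_sq]
  have hbsymm : ∀ η : ℂ, ‖η‖ ^ 2 < φ w → ∀ j,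
      b η j * ((‖η₀‖ ^ 2 : ℝ) : ℂ) ^ j = (starRingEnd ℂ) (b η₀ j) * ((‖η‖ ^ 2 : ℝ) : ℂ) ^ j := by
    intro η hη j
    have := (extractsTaylorCoeff_complex j η₀).taylorCoeff_mul_eq_conj
      (extractsTaylorCoeff_complex j η) hDopen hφcont hφpos
      (hKΩmem _ (hmemΩ hη₀φ)).1 (hKΩmem _ (hmemΩ hη₀φ)).2
      (fun f hf hfi => hKΩrep f hf hfi _ (hmemΩ hη₀φ))
      (hKΩmem _ (hmemΩ hη)).1 (hKΩmem _ (hmemΩ hη)).2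
      (fun f hf hfi => hKΩrep f hf hfi _ (hmemΩ hη))
    rw [hℓ, hℓ, map_mul, map_pow, conj_ofReal] at this
    refine mul_left_cancel₀ ?_ this
    exact_mod_cast (extractsTaylorCoeff_complex j η).pos.ne'
  set c : ℕ → ℝ := fun j => (b η₀ j).re / (‖η₀‖ ^ 2) ^ j with hc
  have hbη₀ : ∀ j, b η₀ j = (c j : ℂ) * ((‖η₀‖ ^ 2 : ℝ) : ℂ) ^ j := by
    intro j
    have h0 : ((‖η₀‖ ^ 2 : ℝ) : ℂ) ^ j ≠ 0 := by
      exact_mod_cast pow_ne_zero j (pow_ne_zero 2 hη₀')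
    have h1 := mul_right_cancel₀ h0 (hbsymm η₀ hη₀φ j)
    have h2 : ((b η₀ j).re : ℂ) = b η₀ j := conj_eq_iff_re.1 h1.symm
    simp only [hc]
    rw [ofReal_div, h2, ofReal_pow, div_mul_cancel₀ _ h0]
  have hbη : ∀ η : ℂ, ‖η‖ ^ 2 < φ w → ∀ j, b η j = ((c j * (‖η‖ ^ 2) ^ j : ℝ) : ℂ) := by
    intro η hη j
    have h0 : ((‖η₀‖ ^ 2 : ℝ) : ℂ) ^ j ≠ 0 := by
      exact_mod_cast pow_ne_zero j (pow_ne_zero 2 hη₀')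
    refine mul_right_cancel₀ h0 ((hbsymm η hη j).trans ?_)
    rw [hbη₀, map_mul, map_pow, conj_ofReal, conj_ofReal]
    push_cast
    ring
  have hL : ∀ r, 0 ≤ r → r < φ w → HasSum (fun j => c j * r ^ j) (L w r) := by
    intro r hr hrφ
    have hη : ‖((√r : ℝ) : ℂ)‖ ^ 2 = r := by
      rw [norm_real, Real.norm_of_nonneg (Real.sqrt_nonneg _), Real.sq_sqrt hr]
    have hmem := hmemΩ (hη.trans_lt hrφ)
    have h1 := hasSum_taylorCoeff_hartogs (N := fun ζ : ℂ => ‖ζ‖ ^ 2)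
      (fun t Z => by rw [norm_smul, mul_pow]) (fun Z => by positivity) (hKΩmem _ hmem).1 hmem
    rw [hLK _ hmem] at h1
    have h2 := fun j => hbη _ (hη.trans_lt hrφ) j
    simp only [hb] at h2
    simp only [h2, hη] at h1
    exact hasSum_ofReal.1 h1
  have ha : ∀ k, (taylorCoeff k fun t => KG (w, t • W) (w, W)) =
      ((1 / ((M + 1).factorial : ℝ) * (((M + k).factorial / k.factorial : ℝ) * c (M + k) *
        (∑ i, ‖W i‖ ^ 2) ^ k) : ℝ) : ℂ) := by
    intro k
    have := (extractsTaylorCoeff_complex (M + k) η₀).taylorCoeff_mul_eq_conj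
      (extractsTaylorCoeff_pi M k W) hDopen hφcont hφpos
      (hKΩmem _ (hmemΩ hη₀φ)).1 (hKΩmem _ (hmemΩ hη₀φ)).2
      (fun f hf hfi => hKΩrep f hf hfi _ (hmemΩ hη₀φ))
      (hKGmem _ hq).1 (hKGmem _ hq).2 (fun f hf hfi => hKGrep f hf hfi _ hq)
    rw [hℓ, hℓW] at this
    change _ = _ * (starRingEnd ℂ) (b η₀ (M + k) * _) at this
    rw [hbη₀, map_mul, map_mul, map_pow, map_pow, conj_ofReal, conj_ofReal, conj_ofReal] at this
    have h0 : ((‖η₀‖ ^ 2 : ℝ) : ℂ) ^ (M + k) ≠ 0 := by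
      exact_mod_cast pow_ne_zero _ (pow_ne_zero 2 hη₀')
    set x := taylorCoeff k fun t => KG (w, t • W) (w, W)
    have hC : (((M + 1).factorial * k.factorial / (M + k + 1).factorial : ℝ) : ℂ) ≠ 0 := by
      exact_mod_cast (extractsTaylorCoeff_pi M k W).pos.ne'
    refine mul_left_cancel₀ (mul_ne_zero hC h0) ?_
    rw [mul_assoc, mul_comm _ x, this, Nat.factorial_succ (M + k)]
    have h1 := Nat.factorial_ne_zero (M + k)
    have h2 := Nat.factorial_ne_zero (M + 1)
    have h3 := Nat.factorial_ne_zero k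
    push_cast
    have h4 : (M + k + 1 : ℂ) ≠ 0 := by exact_mod_cast Nat.succ_ne_zero (M + k)
    field_simp
  have hsum := hasSum_taylorCoeff_hartogs (N := fun Z : Fin (M + 1) → ℂ => ∑ i, ‖Z i‖ ^ 2)
    (fun t Z => by simp [mul_pow, Finset.mul_sum]) (fun Z => by positivity) (hKGmem _ hq).1 hq
  simp only [ha] at hsum
  exact hsum.unique (hasSum_ofReal.2
    ((hasSum_iteratedDerivWithin_of_hasSum M hL (by positivity) hWφ).mul_left _))
end

section
/- Let m be a positive integer, let B_m = {Z ∈ ℂ^m : ‖Z‖² < 1} be the unit Hermitian ball, and let ν = (m!/π^m)·Lebesgue measure on B_m (so that ν(B_m) = 1). Then the Bergman kernel of the Bergman space A²(B_m, ν) is K(Z,T) = (1 - ⟨Z,T⟩)^{-(m+1)}, where ⟨Z,T⟩ = Σ_{i=1}^m Z_i conj(T_i): that is, for each T ∈ B_m the function Z ↦ (1-⟨Z,T⟩)^{-(m+1)} belongs to A²(B_m,ν), and for every holomorphic f on B_m with ∫_{B_m} |f|² dν < ∞ and every Z ∈ B_m one has f(Z) = ∫_{B_m} (1 - ⟨Z,T⟩)^{-(m+1)}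 f(T) dν(T). In particular the Bergman kernel function on the diagonal is K(Z,Z) = (1 - ‖Z‖²)^{-(m+1)}. -/
open MeasureTheory Complex

/-- The open unit ball of the Hermitian norm on `ι → ℂ`. -/
def hermitianBall (ι : Type*) [Fintype ι] : Set (ι → ℂ) := {T | ∑ i, ‖T i‖ ^ 2 < 1}

section HermitianBall

variable {ι : Type*} [Fintype ι]

lemma mem_hermitianBall {T : ι → ℂ} : T ∈ hermitianBall ι ↔ ∑ i, ‖T i‖ ^ 2 < 1 := Iff.rfl

lemma isOpen_hermitianBall : IsOpen (hermitianBall ι) :=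
  isOpen_lt (by fun_prop) continuous_const

lemma zero_mem_hermitianBall : (0 : ι → ℂ) ∈ hermitianBall ι := by
  simp [mem_hermitianBall]

lemma norm_sq_lt_one_of_mem_hermitianBall {T : ι → ℂ} (hT : T ∈ hermitianBall ι) (i : ι) :
    ‖T i‖ ^ 2 < 1 :=
  (Finset.single_le_sum (f := fun i => ‖T i‖ ^ 2) (fun _ _ => by positivity)
    (Finset.mem_univ i)).trans_lt hT

lemma norm_lt_one_of_mem_hermitianBall {T : ι → ℂ} (hT : T ∈ hermitianBall ι) (i : ι) :
    ‖T i‖ < 1 :=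
  (sq_lt_one_iff₀ (norm_nonneg _)).1 (norm_sq_lt_one_of_mem_hermitianBall hT i)

lemma mem_hermitianBall_of_norm_le {S T : ι → ℂ} (hT : T ∈ hermitianBall ι)
    (h : ∀ i, ‖S i‖ ≤ ‖T i‖) : S ∈ hermitianBall ι :=
  (Finset.sum_le_sum fun i _ => pow_le_pow_left₀ (norm_nonneg _) (h i) 2).trans_lt hT

lemma single_mem_hermitianBall [DecidableEq ι] {i : ι} {w : ℂ} (hw : ‖w‖ < 1) :
    Pi.single i w ∈ hermitianBall ι := by
  rw [mem_hermitianBall, Finset.sum_eq_single i]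
  · simpa using pow_lt_one₀ (norm_nonneg w) hw two_ne_zero
  · intro j _ hj; simp [hj]
  · simp

lemma volume_hermitianBall_lt_top : volume (hermitianBall ι) < ⊤ := by
  refine (measure_mono (t := Metric.ball 0 1) fun T hT => ?_).trans_lt measure_ball_lt_top
  rw [mem_ball_zero_iff, pi_norm_lt_iff one_pos]
  exact norm_lt_one_of_mem_hermitianBall hT

lemma volume_hermitianBall_ne_zero : volume (hermitianBall ι) ≠ 0 :=
  (isOpen_hermitianBall.measure_pos volume ⟨0, zero_mem_hermitianBall⟩).ne'

instance : IsFiniteMeasure (volume.restrict (hermitianBall ι)) :=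
  isFiniteMeasure_restrict.2 volume_hermitianBall_lt_top.ne

/-- Linear maps preserving the Hermitian norm preserve Lebesgue measure on the ball. -/
lemma measurePreserving_restrict_hermitianBall (L : (ι → ℂ) →ₗ[ℂ] (ι → ℂ))
    (hL : ∀ T, ∑ i, ‖L T i‖ ^ 2 = ∑ i, ‖T i‖ ^ 2) :
    MeasurePreserving L (volume.restrict (hermitianBall ι))
      (volume.restrict (hermitianBall ι)) := by
  have hinj : Function.Injective L := by
    rw [injective_iff_map_eq_zero]
    intro T hT
    have h := hL T
    rw [hT] at h
    simp only [Pi.zero_apply, norm_zero, ne_eq, OfNat.ofNat_ne_zero, not_false_eq_true, zero_pow,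
      Finset.sum_const_zero] at h
    ext i
    have := (Finset.sum_eq_zero_iff_of_nonneg (fun _ _ => by positivity)).1 h.symm i
      (Finset.mem_univ i)
    simpa using this
  have hsurj : Function.Surjective L := LinearMap.injective_iff_surjective.1 hinj
  have hpre : L ⁻¹' hermitianBall ι = hermitianBall ι := by
    ext T; simp [mem_hermitianBall, hL]
  set R : (ι → ℂ) →ₗ[ℝ] (ι → ℂ) := L.restrictScalars ℝ with hR
  have himg : R '' hermitianBall ι = hermitianBall ι := by
    conv_lhs => rw [← hpre]
    exact Set.image_preimage_eq _ hsurj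
  have hdet : |LinearMap.det R| = 1 := by
    have h := Measure.addHaar_image_linearMap volume R (hermitianBall ι)
    rw [himg] at h
    have h1 : ENNReal.ofReal |LinearMap.det R| = 1 :=
      ((ENNReal.mul_eq_right volume_hermitianBall_ne_zero volume_hermitianBall_lt_top.ne).1 h.symm)
    simpa using h1
  have hne : LinearMap.det R ≠ 0 := by
    intro h; simp [h] at hdet
  have hmp : MeasurePreserving L (volume : Measure (ι → ℂ)) volume := by
    refine ⟨(LinearMap.continuous_of_finiteDimensional L).measurable, ?_⟩
    have := Measure.map_linearMap_addHaar_eq_smul_addHaar (volume : Measure (ι → ℂ)) hne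
    rw [abs_inv, hdet, inv_one, ENNReal.ofReal_one, one_smul] at this
    exact this
  have := hmp.restrict_preimage isOpen_hermitianBall.measurableSet
  rwa [hpre] at this

end HermitianBall

lemma circleAverage_eq_average {X : Type*} [MeasurableSpace X] {μ : Measure X} [SFinite μ]
    {R : ℂ → X → X} (hm : Measurable (Function.uncurry R))
    (hR : ∀ z, ‖z‖ = 1 → MeasurePreserving (R z) μ μ) {F : X → ℂ} (hF : Integrable F μ) :
    Integrable (fun x => Real.circleAverage (fun z => F (R z x)) 0 1) μ ∧
      ∫ x, Real.circleAverage (fun z => F (R z x)) 0 1 ∂μ = ∫ x, F x ∂μ := by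
  set τ : Measure ℝ := volume.restrict (Set.Ioc 0 (2 * Real.pi)) with hτ
  have hnorm (θ : ℝ) : ‖circleMap 0 1 θ‖ = 1 := by simp
  have hmp : MeasurePreserving (fun p : ℝ × X => (p.1, R (circleMap 0 1 p.1) p.2))
      (τ.prod μ) (τ.prod μ) :=
    (MeasurePreserving.id τ).skew_product (g := fun θ x => R (circleMap 0 1 θ) x)
      (hm.comp (((continuous_circleMap 0 1).measurable.comp measurable_fst).prodMk measurable_snd))
      (Filter.Eventually.of_forall fun θ => (hR _ (hnorm θ)).map_eq)
  have hint : Integrable (fun p : ℝ × X => F (R (circleMap 0 1 p.1) p.2)) (τ.prod μ) :=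
    hmp.integrable_comp_of_integrable (hF.comp_snd τ)
  have havg (x : X) : Real.circleAverage (fun z => F (R z x)) 0 1
      = (2 * Real.pi)⁻¹ • ∫ θ, F (R (circleMap 0 1 θ) x) ∂τ := by
    rw [Real.circleAverage_def, intervalIntegral.integral_of_le Real.two_pi_pos.le]
  simp only [havg]
  refine ⟨hint.integral_prod_right.smul (2 * Real.pi)⁻¹, ?_⟩
  rw [integral_smul, ← integral_integral_swap hint]
  have hθ (θ : ℝ) : ∫ x, F (R (circleMap 0 1 θ) x) ∂μ = ∫ x, F x ∂μ := by
    have h := hR _ (hnorm θ)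
    conv_rhs => rw [← h.map_eq]
    rw [integral_map h.aemeasurable (by rw [h.map_eq]; exact hF.1)]
  simp only [hθ, integral_const, hτ, measureReal_restrict_apply_univ, Real.volume_real_Ioc]
  rw [sub_zero, max_eq_left Real.two_pi_pos.le, smul_smul,
    inv_mul_cancel₀ Real.two_pi_pos.ne', one_smul]

lemma circleAverage_conj_pow_mul {g : ℂ → ℂ} (hg : DifferentiableOn ℂ g (Metric.ball 0 1))
    {w : ℂ} (hw : ‖w‖ < 1) (k : ℕ) :
    Real.circleAverage (fun z => (starRingEnd ℂ) (z * w) ^ k * g (z * w)) 0 1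
      = ((k.factorial : ℂ)⁻¹ * iteratedDeriv k g 0) * ((‖w‖ ^ 2) ^ k : ℝ) := by
  have hmaps : Set.MapsTo (w * ·) (Metric.ball (0 : ℂ) 1) (Metric.ball 0 1) := by
    intro z hz
    rw [mem_ball_zero_iff] at hz ⊢
    rw [norm_mul]
    nlinarith [norm_nonneg w, norm_nonneg z]
  have hmaps' : Set.MapsTo (w * ·) (Metric.closedBall (0 : ℂ) 1) (Metric.ball 0 1) := by
    intro z hz
    rw [mem_closedBall_zero_iff] at hz
    rw [mem_ball_zero_iff, norm_mul]
    nlinarith [norm_nonneg w, norm_nonneg z]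
  have hh : DiffContOnCl ℂ (fun z => g (w * z)) (Metric.ball 0 1) := by
    apply DifferentiableOn.diffContOnCl
    rw [closure_ball _ one_ne_zero]
    exact hg.comp (by fun_prop) hmaps'
  have hder : iteratedDeriv k (fun z => g (w * z)) 0 = w ^ k * iteratedDeriv k g 0 := by
    have h0 : (0 : ℂ) ∈ Metric.ball (0 : ℂ) 1 := by simp
    have h := iteratedDerivWithin_comp_const_smul (n := k) h0 Metric.isOpen_ball.uniqueDiffOn
      (hg.contDiffOn Metric.isOpen_ball) w hmaps
    rw [iteratedDerivWithin_of_isOpen Metric.isOpen_ball h0, mul_zero,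
      iteratedDerivWithin_of_isOpen Metric.isOpen_ball h0] at h
    simpa using h
  have hC := hh.circleIntegral_one_div_sub_center_pow_smul one_pos k
  rw [Real.circleAverage_eq_circleIntegral one_ne_zero]
  have hcongr : (∮ z in C((0 : ℂ), 1), (z - 0)⁻¹ • ((starRingEnd ℂ) (z * w) ^ k * g (z * w)))
      = ∮ z in C((0 : ℂ), 1), (starRingEnd ℂ) w ^ k * ((1 / (z - 0) ^ (k + 1)) • g (w * z)) := by
    refine circleIntegral.integral_congr zero_le_one fun z hz => ?_
    have hz1 : ‖z‖ = 1 := by simpa using hz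
    have hconj : (starRingEnd ℂ) z = z⁻¹ := by
      rw [Complex.inv_def, Complex.normSq_eq_norm_sq, hz1]; simp
    simp only [map_mul, hconj, sub_zero, smul_eq_mul, mul_pow, inv_pow, one_div, pow_succ, mul_inv,
      mul_comm w z]
    ring
  rw [hcongr, circleIntegral.integral_const_mul, hC, hder]
  have hw2 : (((‖w‖ ^ 2) ^ k : ℝ) : ℂ) = (starRingEnd ℂ) w ^ k * w ^ k := by
    rw [← mul_pow, Complex.conj_mul']; push_cast; ring
  rw [hw2]
  have := Complex.two_pi_I_ne_zero
  simp only [smul_eq_mul]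
  field_simp

lemma integral_pow_mul_one_sub_sq_pow (n k : ℕ) :
    ∫ y in (0 : ℝ)..1, y ^ (2 * k + 1) * (1 - y ^ 2) ^ n
      = (k.factorial * n.factorial : ℝ) / (2 * (k + n + 1).factorial) := by
  induction n generalizing k with
  | zero =>
    simp only [pow_zero, mul_one, integral_pow, one_pow, Nat.factorial_zero, Nat.cast_one,
      add_zero, Nat.factorial_succ]
    have : (k.factorial : ℝ) ≠ 0 := by positivity
    push_cast
    field_simp
    simp
    ring
  | succ n ih =>
    have hsplit (y : ℝ) : y ^ (2 * k + 1) * (1 - y ^ 2) ^ (n + 1)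
        = y ^ (2 * k + 1) * (1 - y ^ 2) ^ n - y ^ (2 * (k + 1) + 1) * (1 - y ^ 2) ^ n := by ring
    simp only [hsplit]
    rw [intervalIntegral.integral_sub
      (Continuous.intervalIntegrable (by fun_prop) _ _)
      (Continuous.intervalIntegrable (by fun_prop) _ _), ih, ih,
      show k + 1 + n + 1 = k + n + 1 + 1 by ring, show k + (n + 1) + 1 = k + n + 1 + 1 by ring]
    simp only [Nat.factorial_succ]
    have h1 : (k.factorial : ℝ) ≠ 0 := by positivity
    have h2 : (n.factorial : ℝ) ≠ 0 := by positivity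
    have h3 : ((k + n).factorial : ℝ) ≠ 0 := by positivity
    push_cast
    field_simp
    ring

lemma volume_sum_norm_sq_lt (n : ℕ) {s : ℝ} (hs : 0 < s) :
    (volume {x : Fin n → ℂ | ∑ i, ‖x i‖ ^ 2 < s}).toReal
      = Real.pi ^ n / n.factorial * s ^ n := by
  rcases n.eq_zero_or_pos with rfl | hn
  · have : {x : Fin 0 → ℂ | ∑ i, ‖x i‖ ^ 2 < s} = Set.univ := by ext; simp [hs]
    rw [this, volume_pi, Measure.pi_of_empty]
    simp
  · have : Nonempty (Fin n) := ⟨⟨0, hn⟩⟩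
    have h := Complex.volume_sum_rpow_lt (Fin n) one_le_two (√s)
    have hset : {x : Fin n → ℂ | (∑ i, ‖x i‖ ^ (2 : ℝ)) ^ (1 / (2 : ℝ)) < √s}
        = {x : Fin n → ℂ | ∑ i, ‖x i‖ ^ 2 < s} := by
      ext x
      simp only [Real.rpow_ofNat, ← Real.sqrt_eq_rpow, Set.mem_ofPred_eq]
      exact Real.sqrt_lt_sqrt_iff (by positivity)
    rw [hset] at h
    rw [h, ENNReal.toReal_mul, ENNReal.toReal_pow, ENNReal.toReal_ofReal (by positivity),
      Fintype.card_fin, ENNReal.toReal_ofReal, pow_mul, Real.sq_sqrt hs.le,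
      mul_div_cancel_left₀ _ two_ne_zero, Real.Gamma_nat_eq_factorial]
    · norm_num; ring
    · norm_num
      rw [Real.Gamma_nat_eq_factorial]
      positivity

lemma integral_hermitianBall_norm_pow (n k : ℕ) :
    ∫ T in hermitianBall (Fin (n + 1)), (‖T 0‖ ^ 2) ^ k
      = Real.pi ^ (n + 1) * k.factorial / (n + 1 + k).factorial := by
  set e := MeasurableEquiv.piFinSuccAbove (fun _ : Fin (n + 1) => ℂ) 0
  have he : MeasurePreserving e.symm volume volume :=
    (volume_preserving_piFinSuccAbove (fun _ : Fin (n + 1) => ℂ) 0).symm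
  set φ : (Fin (n + 1) → ℂ) → ℝ :=
    (hermitianBall (Fin (n + 1))).indicator fun T => (‖T 0‖ ^ 2) ^ k with hφ
  have hmeas : MeasurableSet (hermitianBall (Fin (n + 1))) := isOpen_hermitianBall.measurableSet
  have hint : Integrable φ := by
    rw [hφ, integrable_indicator_iff hmeas]
    refine Integrable.of_bound (C := 1) (Continuous.aestronglyMeasurable (by fun_prop)) ?_
    filter_upwards [ae_restrict_mem hmeas] with T hT
    rw [Real.norm_of_nonneg (by positivity)]
    exact pow_le_one₀ (by positivity) (norm_sq_lt_one_of_mem_hermitianBall hT 0).le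
  have hslice (w : ℂ) : ∫ x : Fin n → ℂ, φ (e.symm (w, x))
      = (‖w‖ ^ 2) ^ k * (if ‖w‖ < 1 then Real.pi ^ n / n.factorial * (1 - ‖w‖ ^ 2) ^ n else 0) := by
    have hS : MeasurableSet {x : Fin n → ℂ | ∑ i, ‖x i‖ ^ 2 < 1 - ‖w‖ ^ 2} :=
      (isOpen_lt (by fun_prop) continuous_const).measurableSet
    have hfun : (fun x : Fin n → ℂ => φ (e.symm (w, x)))
        = {x : Fin n → ℂ | ∑ i, ‖x i‖ ^ 2 < 1 - ‖w‖ ^ 2}.indicator fun _ => (‖w‖ ^ 2) ^ k := by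
      funext x
      have h0 : e.symm (w, x) = Fin.cons w x := by
        simp [e, MeasurableEquiv.piFinSuccAbove]
        rfl
      classical
      simp only [hφ, Set.indicator_apply, h0, mem_hermitianBall, Fin.sum_univ_succ, Fin.cons_zero,
        Fin.cons_succ, Set.mem_ofPred_eq, lt_sub_iff_add_lt']
    rw [hfun, integral_indicator_const _ hS, smul_eq_mul, mul_comm, measureReal_def]
    congr 1
    split_ifs with hw
    · exact volume_sum_norm_sq_lt n (sub_pos.2 (pow_lt_one₀ (norm_nonneg w) hw two_ne_zero))
    · have : {x : Fin n → ℂ | ∑ i, ‖x i‖ ^ 2 < 1 - ‖w‖ ^ 2} = ∅ := by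
        ext x
        have h1 : 1 ≤ ‖w‖ ^ 2 := one_le_pow₀ (not_lt.1 hw)
        have h2 : 0 ≤ ∑ i, ‖x i‖ ^ 2 := by positivity
        simp only [Set.mem_ofPred_eq, Set.mem_empty_iff_false, iff_false]
        linarith
      simp [this]
  have hint' : Integrable (fun p : ℂ × (Fin n → ℂ) => φ (e.symm p)) (volume.prod volume) :=
    he.integrable_comp_of_integrable hint
  rw [← integral_indicator hmeas, ← he.integral_comp' (g := φ),
    Measure.volume_eq_prod, integral_prod _ hint']
  simp only [hslice]
  rw [integral_fun_norm_addHaar volume (fun r : ℝ => (r ^ 2) ^ k *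
    (if r < 1 then Real.pi ^ n / n.factorial * (1 - r ^ 2) ^ n else 0))]
  have hI : ∫ y in Set.Ioi (0 : ℝ), y ^ (Module.finrank ℝ ℂ - 1) • ((y ^ 2) ^ k *
      (if y < 1 then Real.pi ^ n / n.factorial * (1 - y ^ 2) ^ n else 0))
      = Real.pi ^ n / n.factorial * ∫ y in (0 : ℝ)..1, y ^ (2 * k + 1) * (1 - y ^ 2) ^ n := by
    rw [intervalIntegral.integral_of_le zero_le_one, integral_Ioc_eq_integral_Ioo,
      ← integral_const_mul, ← integral_indicator measurableSet_Ioi,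
      ← integral_indicator measurableSet_Ioo]
    congr 1
    funext y
    by_cases h0 : 0 < y <;> by_cases h1 : y < 1 <;>
      simp [h0, h1]
    ring
  rw [hI, integral_pow_mul_one_sub_sq_pow, Complex.finrank_real_complex, measureReal_def,
    Complex.volume_ball, show n + 1 + k = k + n + 1 by ring]
  have h1 : (n.factorial : ℝ) ≠ 0 := by positivity
  simp
  field_simp
  ring

section Integrals

variable {ι : Type*} [Fintype ι]

lemma measurePreserving_mul_hermitianBall {a : ι → ℂ} (ha : ∀ i, ‖a i‖ = 1) :
    MeasurePreserving (fun T i => a i * T i) (volume.restrict (hermitianBall ι))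
      (volume.restrict (hermitianBall ι)) := by
  have hL : ⇑(LinearMap.pi fun i => a i • LinearMap.proj (R := ℂ) (φ := fun _ : ι => ℂ) i)
      = fun T i => a i * T i := by ext; simp
  rw [← hL]
  exact measurePreserving_restrict_hermitianBall _ fun T => by simp [ha]

end Integrals

lemma differentiableOn_comp_single {ι : Type*} [Fintype ι] [DecidableEq ι] (i : ι)
    {f : (ι → ℂ) → ℂ} (hf : DifferentiableOn ℂ f (hermitianBall ι)) :
    DifferentiableOn ℂ (fun w : ℂ => f (Pi.single i w)) (Metric.ball 0 1) :=
  hf.comp (differentiable_pi.2 fun j => by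
      rcases eq_or_ne j i with rfl | h
      · simp
      · simp [h]).differentiableOn
    fun _ hw => single_mem_hermitianBall (mem_ball_zero_iff.1 hw)

/-- The pairing of a holomorphic function with `T ↦ (T 0)ᵏ` extracts the `k`-th Taylor coefficient
of its restriction to the first coordinate axis. -/
lemma integral_hermitianBall_conj_pow_mul (n k : ℕ) {f : (Fin (n + 1) → ℂ) → ℂ}
    (hf : DifferentiableOn ℂ f (hermitianBall (Fin (n + 1))))
    (hfi : IntegrableOn f (hermitianBall (Fin (n + 1)))) :
    ∫ T in hermitianBall (Fin (n + 1)), (starRingEnd ℂ) (T 0) ^ k * f T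
      = ((k.factorial : ℂ)⁻¹ * iteratedDeriv k (fun w => f (Pi.single 0 w)) 0) *
        (Real.pi ^ (n + 1) * k.factorial / (n + 1 + k).factorial : ℝ) := by
  have hmeas : MeasurableSet (hermitianBall (Fin (n + 1))) := isOpen_hermitianBall.measurableSet
  have hF : IntegrableOn (fun T => (starRingEnd ℂ) (T 0) ^ k * f T)
      (hermitianBall (Fin (n + 1))) := by
    refine Integrable.bdd_mul (c := 1) hfi (Continuous.aestronglyMeasurable (by fun_prop)) ?_
    filter_upwards [ae_restrict_mem hmeas] with T hT
    rw [norm_pow, RCLike.norm_conj]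
    exact pow_le_one₀ (norm_nonneg _) (norm_lt_one_of_mem_hermitianBall hT 0).le
  -- Rotating the coordinates other than the first one replaces `f T` by `f (T 0, 0, …, 0)`.
  obtain ⟨hint, heq⟩ := circleAverage_eq_average
    (R := fun z (T : Fin (n + 1) → ℂ) i => (if i = 0 then 1 else z) * T i)
    (measurable_pi_lambda _ fun i => by simp only [Function.uncurry]; split_ifs <;> fun_prop)
    (fun z hz => measurePreserving_mul_hermitianBall fun i => by split_ifs <;> simp [hz]) hF
  have havg : ∀ᵐ T ∂volume.restrict (hermitianBall (Fin (n + 1))),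
      Real.circleAverage (fun z => (starRingEnd ℂ) ((if (0 : Fin (n + 1)) = 0 then 1 else z) * T 0)
        ^ k * f (fun i => (if i = 0 then 1 else z) * T i)) 0 1
      = (starRingEnd ℂ) (T 0) ^ k * f (Pi.single 0 (T 0)) := by
    filter_upwards [ae_restrict_mem hmeas] with T hT
    have hd : DiffContOnCl ℂ (fun z : ℂ => (starRingEnd ℂ) (T 0) ^ k *
        f (fun i => (if i = 0 then 1 else z) * T i)) (Metric.ball 0 |1|) := by
      apply DifferentiableOn.diffContOnCl
      rw [abs_one, closure_ball _ one_ne_zero]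
      refine (hf.comp (differentiable_pi.2 fun i => ?_).differentiableOn fun z hz => ?_).const_mul _
      · split_ifs <;> fun_prop
      · refine mem_hermitianBall_of_norm_le hT fun i => ?_
        rw [mem_closedBall_zero_iff] at hz
        split_ifs
        · simp
        · rw [norm_mul]
          exact mul_le_of_le_one_left (norm_nonneg _) hz
    have h := hd.circleAverage
    simp only [if_true, one_mul]
    rw [h]
    congr 2
    funext i
    rcases eq_or_ne i 0 with rfl | hi
    · simp
    · simp [hi]
  rw [← heq, integral_congr_ae havg]
  -- Rotating all coordinates isolates the `k`-th Taylor coefficient.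
  obtain ⟨-, heq'⟩ := circleAverage_eq_average
    (R := fun z (T : Fin (n + 1) → ℂ) i => z * T i)
    (measurable_pi_lambda _ fun i => by fun_prop)
    (fun z hz => measurePreserving_mul_hermitianBall fun _ => hz) (hint.congr havg)
  rw [← heq', ← integral_hermitianBall_norm_pow, ← integral_complex_ofReal, ← integral_const_mul]
  refine setIntegral_congr_fun hmeas fun T hT => ?_
  exact circleAverage_conj_pow_mul (differentiableOn_comp_single 0 hf)
    (norm_lt_one_of_mem_hermitianBall hT 0) k

/-- The reproducing property at points of the first coordinate axis. -/
lemma integral_hermitianBall_kernel_single (n : ℕ) {f : (Fin (n + 1) → ℂ) → ℂ}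
    (hf : DifferentiableOn ℂ f (hermitianBall (Fin (n + 1))))
    (hfi : IntegrableOn f (hermitianBall (Fin (n + 1)))) {z : ℂ} (hz : ‖z‖ < 1) :
    ∫ T in hermitianBall (Fin (n + 1)), ((1 - z * (starRingEnd ℂ) (T 0)) ^ (n + 2))⁻¹ * f T
      = (Real.pi ^ (n + 1) / (n + 1).factorial : ℝ) * f (Pi.single 0 z) := by
  have hmeas : MeasurableSet (hermitianBall (Fin (n + 1))) := isOpen_hermitianBall.measurableSet
  set c : ℕ → ℂ := fun k => ((k + (n + 1)).choose (n + 1) : ℂ) * z ^ k with hc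
  have hcsum : Summable fun k => ‖c k‖ := by
    have := (hasSum_choose_mul_geometric_of_norm_lt_one (𝕜 := ℝ) (n + 1) (r := ‖z‖)
      (by simpa using hz)).summable
    simpa [hc] using this
  have hbound (k : ℕ) : ∀ᵐ T ∂volume.restrict (hermitianBall (Fin (n + 1))),
      ‖c k * (starRingEnd ℂ) (T 0) ^ k‖ ≤ ‖c k‖ := by
    filter_upwards [ae_restrict_mem hmeas] with T hT
    rw [norm_mul, norm_pow, RCLike.norm_conj]
    exact mul_le_of_le_one_right (norm_nonneg _)
      (pow_le_one₀ (norm_nonneg _) (norm_lt_one_of_mem_hermitianBall hT 0).le)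
  have hFint (k : ℕ) : IntegrableOn (fun T => c k * (starRingEnd ℂ) (T 0) ^ k * f T)
      (hermitianBall (Fin (n + 1))) :=
    Integrable.bdd_mul hfi (Continuous.aestronglyMeasurable (by fun_prop)) (hbound k)
  have hFsum : Summable fun k => ∫ T in hermitianBall (Fin (n + 1)),
      ‖c k * (starRingEnd ℂ) (T 0) ^ k * f T‖ := by
    refine Summable.of_nonneg_of_le (fun k => integral_nonneg fun _ => norm_nonneg _)
      (fun k => ?_) (hcsum.mul_right (∫ T in hermitianBall (Fin (n + 1)), ‖f T‖))
    rw [← integral_const_mul]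
    refine integral_mono_ae (hFint k).norm (hfi.norm.const_mul _) ?_
    filter_upwards [hbound k] with T hT
    rw [norm_mul]
    exact mul_le_mul_of_nonneg_right hT (norm_nonneg _)
  have hS := hasSum_integral_of_summable_integral_norm hFint hFsum
  have hker : ∫ T in hermitianBall (Fin (n + 1)), (∑' k, c k * (starRingEnd ℂ) (T 0) ^ k * f T)
      = ∫ T in hermitianBall (Fin (n + 1)),
        ((1 - z * (starRingEnd ℂ) (T 0)) ^ (n + 2))⁻¹ * f T := by
    refine setIntegral_congr_fun hmeas fun T hT => ?_
    have hlt : ‖z * (starRingEnd ℂ) (T 0)‖ < 1 := by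
      rw [norm_mul, RCLike.norm_conj]
      exact mul_lt_one_of_nonneg_of_lt_one_left (norm_nonneg _) hz
        (norm_lt_one_of_mem_hermitianBall hT 0).le
    have h := (hasSum_choose_mul_geometric_of_norm_lt_one (n + 1) hlt).mul_right (f T)
    rw [one_div] at h
    rw [← h.tsum_eq]
    simp only [hc, mul_pow, mul_assoc]
  rw [hker] at hS
  have hT := (Complex.hasSum_taylorSeries_on_ball (differentiableOn_comp_single 0 hf)
    (mem_ball_zero_iff.2 hz)).mul_left ((Real.pi ^ (n + 1) / (n + 1).factorial : ℝ) : ℂ)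
  refine hS.unique (hT.congr_fun fun k => ?_)
  simp only [mul_assoc (c k)]
  rw [integral_const_mul, integral_hermitianBall_conj_pow_mul n k hf hfi]
  have hch : ((k + (n + 1)).choose (n + 1) : ℂ)
      = (k + (n + 1)).factorial / ((n + 1).factorial * k.factorial) := by
    rw [Nat.cast_choose ℂ (Nat.le_add_left _ _), Nat.add_sub_cancel]
  have h1 : ((k + (n + 1)).factorial : ℂ) ≠ 0 := mod_cast (Nat.factorial_ne_zero _)
  have h2 : ((n + 1).factorial : ℂ) ≠ 0 := mod_cast (Nat.factorial_ne_zero _)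
  have h3 : (k.factorial : ℂ) ≠ 0 := mod_cast (Nat.factorial_ne_zero _)
  simp only [hc, hch, sub_zero, smul_eq_mul, add_comm (n + 1) k]
  push_cast
  field_simp

lemma exists_linearMap_preserving_inner (n : ℕ) (Z : Fin (n + 1) → ℂ) :
    ∃ L : (Fin (n + 1) → ℂ) →ₗ[ℂ] (Fin (n + 1) → ℂ),
      (∀ S T, ∑ i, L S i * (starRingEnd ℂ) (L T i) = ∑ i, S i * (starRingEnd ℂ) (T i)) ∧
      ∃ z : ℂ, L (Pi.single 0 z) = Z := by
  set x : EuclideanSpace ℂ (Fin (n + 1)) := WithLp.toLp 2 Z with hx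
  obtain ⟨b, z, hb⟩ : ∃ (b : OrthonormalBasis (Fin (n + 1)) ℂ (EuclideanSpace ℂ (Fin (n + 1))))
      (z : ℂ), z • b 0 = x := by
    rcases eq_or_ne x 0 with h0 | h0
    · exact ⟨EuclideanSpace.basisFun _ ℂ, 0, by simp [h0]⟩
    · have hnx : (‖x‖ : ℂ) ≠ 0 := by simpa using h0
      obtain ⟨b, hb⟩ := Orthonormal.exists_orthonormalBasis_extension_of_card_eq (𝕜 := ℂ)
        (v := fun _ : Fin (n + 1) => (‖x‖ : ℂ)⁻¹ • x) (s := {0}) (by simp) (by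
          refine ⟨fun i => ?_, fun i j hij => (hij (Subsingleton.elim i j)).elim⟩
          simp [norm_smul, h0])
      exact ⟨b, ‖x‖, by rw [hb 0 rfl, smul_smul, mul_inv_cancel₀ hnx, one_smul]⟩
  set e := WithLp.linearEquiv 2 ℂ (Fin (n + 1) → ℂ)
  refine ⟨e.toLinearMap ∘ₗ b.repr.symm.toLinearEquiv.toLinearMap ∘ₗ e.symm.toLinearMap,
    fun S T => ?_, z, ?_⟩
  · have h := b.repr.symm.inner_map_map (e.symm T) (e.symm S)
    simp only [PiLp.inner_apply, RCLike.inner_apply] at h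
    exact h
  · have h : e.symm (Pi.single 0 z) = EuclideanSpace.single 0 z := rfl
    have h' : b.repr.symm (EuclideanSpace.single 0 z) = x := by
      rw [← hb, LinearIsometryEquiv.symm_apply_eq, map_smul, b.repr_self]
      ext i
      simp
    simp [h, h', e, hx]

lemma norm_sum_mul_conj_le {ι : Type*} [Fintype ι] {Z T : ι → ℂ} (hZ : Z ∈ hermitianBall ι) :
    ‖∑ i, Z i * (starRingEnd ℂ) (T i)‖ ≤ √(∑ i, ‖T i‖ ^ 2) := by
  refine Real.le_sqrt_of_sq_le ?_
  calc ‖∑ i, Z i * (starRingEnd ℂ) (T i)‖ ^ 2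
      ≤ (∑ i, ‖Z i‖ * ‖T i‖) ^ 2 := by
        refine pow_le_pow_left₀ (norm_nonneg _) ((norm_sum_le _ _).trans_eq ?_) 2
        simp
    _ ≤ (∑ i, ‖Z i‖ ^ 2) * ∑ i, ‖T i‖ ^ 2 := Finset.sum_mul_sq_le_sq_mul_sq _ _ _
    _ ≤ ∑ i, ‖T i‖ ^ 2 := mul_le_of_le_one_left (by positivity) (mem_hermitianBall.1 hZ).le

lemma one_sub_sqrt_le_norm_one_sub_sum {ι : Type*} [Fintype ι] {Z T : ι → ℂ}
    (hZ : Z ∈ hermitianBall ι) :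
    1 - √(∑ i, ‖T i‖ ^ 2) ≤ ‖(1 : ℂ) - ∑ i, Z i * (starRingEnd ℂ) (T i)‖ := by
  have h := norm_sub_norm_le (1 : ℂ) (∑ i, Z i * (starRingEnd ℂ) (T i))
  rw [norm_one] at h
  linarith [norm_sum_mul_conj_le (T := T) hZ]

lemma one_sub_sqrt_pos {ι : Type*} [Fintype ι] {T : ι → ℂ} (hT : T ∈ hermitianBall ι) :
    0 < 1 - √(∑ i, ‖T i‖ ^ 2) := by
  rw [sub_pos, Real.sqrt_lt' one_pos, one_pow]
  exact hT

lemma differentiableOn_bergmanKernel {ι : Type*} [Fintype ι] {T : ι → ℂ}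
    (hT : T ∈ hermitianBall ι) (N : ℤ) :
    DifferentiableOn ℂ (fun Z : ι → ℂ => ((1 : ℂ) - ∑ i, Z i * (starRingEnd ℂ) (T i)) ^ N)
      (hermitianBall ι) := by
  intro Z hZ
  refine DifferentiableAt.differentiableWithinAt (DifferentiableAt.zpow (by fun_prop) (Or.inl ?_))
  exact norm_pos_iff.1 ((one_sub_sqrt_pos hT).trans_le (one_sub_sqrt_le_norm_one_sub_sum hZ))

lemma integrableOn_norm_sq_bergmanKernel {ι : Type*} [Fintype ι] {T : ι → ℂ}
    (hT : T ∈ hermitianBall ι) (N : ℕ) :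
    IntegrableOn (fun Z : ι → ℂ =>
      ‖((1 : ℂ) - ∑ i, Z i * (starRingEnd ℂ) (T i)) ^ (-(N : ℤ))‖ ^ 2) (hermitianBall ι) := by
  have hmeas : MeasurableSet (hermitianBall ι) := isOpen_hermitianBall.measurableSet
  refine Integrable.of_bound (C := (((1 - √(∑ i, ‖T i‖ ^ 2)) ^ N)⁻¹) ^ 2)
    (((differentiableOn_bergmanKernel hT _).continuousOn.norm.pow 2).aestronglyMeasurable hmeas) ?_
  filter_upwards [ae_restrict_mem hmeas] with Z hZ
  have hpos := one_sub_sqrt_pos hT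
  rw [Real.norm_of_nonneg (by positivity), zpow_neg, zpow_natCast, norm_inv, norm_pow]
  gcongr
  exact one_sub_sqrt_le_norm_one_sub_sum hZ

/-- The reproducing property of the Bergman kernel with respect to Lebesgue measure. -/
lemma integral_hermitianBall_kernel (n : ℕ) {f : (Fin (n + 1) → ℂ) → ℂ}
    (hf : DifferentiableOn ℂ f (hermitianBall (Fin (n + 1))))
    (hfi : IntegrableOn f (hermitianBall (Fin (n + 1)))) {Z : Fin (n + 1) → ℂ}
    (hZ : Z ∈ hermitianBall (Fin (n + 1))) :
    ∫ T in hermitianBall (Fin (n + 1)),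
        ((1 - ∑ i, Z i * (starRingEnd ℂ) (T i)) ^ (n + 2))⁻¹ * f T
      = (Real.pi ^ (n + 1) / (n + 1).factorial : ℝ) * f Z := by
  have hmeas : MeasurableSet (hermitianBall (Fin (n + 1))) := isOpen_hermitianBall.measurableSet
  obtain ⟨L, hL, z, rfl⟩ := exists_linearMap_preserving_inner n Z
  have hnorm (T : Fin (n + 1) → ℂ) : ∑ i, ‖L T i‖ ^ 2 = ∑ i, ‖T i‖ ^ 2 := by
    have h := hL T T
    simp only [Complex.mul_conj'] at h
    exact_mod_cast h
  have hmaps : Set.MapsTo L (hermitianBall (Fin (n + 1))) (hermitianBall (Fin (n + 1))) :=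
    fun T hT => by rwa [mem_hermitianBall, hnorm]
  have hmp := measurePreserving_restrict_hermitianBall L hnorm
  have hz : ‖z‖ < 1 := by
    rw [mem_hermitianBall, hnorm] at hZ
    simpa using norm_lt_one_of_mem_hermitianBall hZ 0
  have hcont : ContinuousOn
      (fun T => ((1 - ∑ i, L (Pi.single 0 z) i * (starRingEnd ℂ) (T i)) ^ (n + 2))⁻¹ * f T)
      (hermitianBall (Fin (n + 1))) := by
    refine ContinuousOn.mul (ContinuousOn.inv₀ (by fun_prop) fun T hT => pow_ne_zero _ ?_)
      hf.continuousOn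
    exact norm_pos_iff.1
      ((one_sub_sqrt_pos hT).trans_le (one_sub_sqrt_le_norm_one_sub_sum hZ))
  have hfL : DifferentiableOn ℂ (fun T => f (L T)) (hermitianBall (Fin (n + 1))) :=
    hf.comp (LinearMap.toContinuousLinearMap L).differentiable.differentiableOn hmaps
  rw [← integral_hermitianBall_kernel_single n hfL (hmp.integrable_comp_of_integrable hfi) hz]
  conv_lhs => rw [← hmp.map_eq]
  rw [integral_map hmp.aemeasurable (by rw [hmp.map_eq]; exact hcont.aestronglyMeasurable hmeas)]
  simp only [hL]
  congr 1
  funext T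
  rw [Fintype.sum_eq_single (0 : Fin (n + 1)) (by simp +contextual)]
  simp

/-- The Bergman kernel of the unit Hermitian ball `B_m = {‖Z‖² < 1} ⊂ ℂ^m` with respect
to the normalized measure `ν = (m!/π^m)·Lebesgue` is `K(Z,T) = (1 - ⟨Z,T⟩)^{-(m+1)}`,
with `⟨Z,T⟩ = Σᵢ Zᵢ conj(Tᵢ)`: for each `T ∈ B_m` the function
`Z ↦ (1-⟨Z,T⟩)^{-(m+1)}` is holomorphic and square-integrable on `B_m`, it reproduces
every square-integrable holomorphic function, and on the diagonal
`K(Z,Z) = (1-‖Z‖²)^{-(m+1)}`. -/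
theorem bergman_kernel_ball (m : ℕ) (hm : 0 < m)
    (B : Set (Fin m → ℂ)) (hB : B = {Z : Fin m → ℂ | ∑ i, ‖Z i‖ ^ 2 < 1})
    (ν : Measure (Fin m → ℂ))
    (hν : ν = (ENNReal.ofReal ((m.factorial : ℝ) / Real.pi ^ m) • volume).restrict B) :
    (∀ T ∈ B,
      DifferentiableOn ℂ
        (fun Z : Fin m → ℂ =>
          ((1 : ℂ) - ∑ i, Z i * (starRingEnd ℂ) (T i)) ^ (-(m + 1 : ℤ))) B ∧
      Integrable
        (fun Z : Fin m → ℂ =>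
          ‖((1 : ℂ) - ∑ i, Z i * (starRingEnd ℂ) (T i)) ^ (-(m + 1 : ℤ))‖ ^ 2) ν) ∧
    (∀ f : (Fin m → ℂ) → ℂ,
      DifferentiableOn ℂ f B → Integrable (fun Z => ‖f Z‖ ^ 2) ν →
      ∀ Z ∈ B,
        f Z = ∫ T, ((1 : ℂ) - ∑ i, Z i * (starRingEnd ℂ) (T i)) ^ (-(m + 1 : ℤ)) * f T ∂ν) ∧
    (∀ Z ∈ B,
      ((1 : ℂ) - ∑ i, Z i * (starRingEnd ℂ) (Z i)) ^ (-(m + 1 : ℤ))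
        = (((1 - ∑ i, ‖Z i‖ ^ 2 : ℝ) : ℂ)) ^ (-(m + 1 : ℤ))) := by
  obtain ⟨n, rfl⟩ : ∃ n, m = n + 1 := ⟨m - 1, by omega⟩
  obtain rfl : B = hermitianBall (Fin (n + 1)) := hB
  have hmeas : MeasurableSet (hermitianBall (Fin (n + 1))) := isOpen_hermitianBall.measurableSet
  have hcpos : (0 : ℝ) < (n + 1).factorial / Real.pi ^ (n + 1) := by positivity
  rw [Measure.restrict_smul] at hν
  have hexp : (-(((n + 1 : ℕ) : ℤ) + 1)) = -((n + 2 : ℕ) : ℤ) := by push_cast; ring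
  rw [hexp]
  refine ⟨fun T hT => ⟨differentiableOn_bergmanKernel hT _, ?_⟩, fun f hf hf2 Z hZ => ?_,
    fun Z _ => ?_⟩
  · rw [hν]
    exact (integrableOn_norm_sq_bergmanKernel hT (n + 2)).smul_measure ENNReal.ofReal_ne_top
  · rw [hν, integrable_smul_measure (by simpa using hcpos) ENNReal.ofReal_ne_top] at hf2
    have hfi : IntegrableOn f (hermitianBall (Fin (n + 1))) :=
      ((memLp_two_iff_integrable_sq_norm (hf.continuousOn.aestronglyMeasurable hmeas)).2
        hf2).integrable one_le_two
    simp only [hν, integral_smul_measure, zpow_neg, zpow_natCast]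
    rw [integral_hermitianBall_kernel n hf hfi hZ, ENNReal.toReal_ofReal hcpos.le,
      Complex.real_smul, ← mul_assoc, ← Complex.ofReal_mul, div_mul_div_cancel₀ (by positivity),
      div_self (by positivity), Complex.ofReal_one, one_mul]
  · simp [Complex.mul_conj']
end
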